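/- (Inequality (5.2) in the proof of Lemma 1.8.) There is a universal constant c > 0 with the following property. Let (v,p) be a suitable weak solution of the Navier–Stokes equations in Q. Then for all radii with 0 < r ≤ ϱ/2 < ϱ ≤ 1, E(r) + D₀(r) ≤ c [ D₀(2r) + (ϱ/r)² C(ϱ) + (ϱ/r)^{4/3} C^{2/3}(ϱ) ]. -/

import Mathlib

open MeasureTheory Metric Set

noncomputable section

/-- Three-dimensional Euclidean space. -/
abbrev E3 := EuclideanSpace ℝ (Fin 3)

/-- The open ball `B(r) ⊆ ℝ³` of radius `r` centered at the origin. -/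
def ballB (r : ℝ) : Set E3 := Metric.ball (0 : E3) r

/-- The time interval `(-r², 0)`. -/
def timeI (r : ℝ) : Set ℝ := Set.Ioo (-r ^ 2) 0

/-- The parabolic cylinder `Q(r) = B(r) × (-r², 0)`. -/
def QSet (r : ℝ) : Set (E3 × ℝ) := ballB r ×ˢ timeI r

/-- The mean value `[f]_{B(r)}` of a function over the ball `B(r)`. -/
def avgB (r : ℝ) (f : E3 → ℝ) : ℝ := ⨍ x in ballB r, f x

/-- `A(r) = ess sup_{-r²<t<0} (1/r) ∫_{B(r)} |v(x,t)|² dx`. -/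
def funA (v : E3 → ℝ → E3) (r : ℝ) : ℝ :=
  essSup (fun t => (1 / r) * ∫ x in ballB r, ‖v x t‖ ^ 2)
    (volume.restrict (timeI r))

/-- `E(r) = (1/r) ∫_{Q(r)} |∇v|² dz`, where `gv` is the (weak) spatial gradient of `v`. -/
def funE (gv : E3 → ℝ → Fin 3 → Fin 3 → ℝ) (r : ℝ) : ℝ :=
  (1 / r) * ∫ t in timeI r, ∫ x in ballB r, ∑ i, ∑ j, (gv x t i j) ^ 2

/-- `C(r) = (1/r²) ∫_{Q(r)} |v|³ dz`. -/
def funC (v : E3 → ℝ → E3) (r : ℝ) : ℝ :=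
  (1 / r ^ 2) * ∫ t in timeI r, ∫ x in ballB r, ‖v x t‖ ^ 3

/-- `D₀(r) = (1/r²) ∫_{Q(r)} |p - [p]_{B(r)}|^{3/2} dz`. -/
def funD0 (p : E3 → ℝ → ℝ) (r : ℝ) : ℝ :=
  (1 / r ^ 2) * ∫ t in timeI r, ∫ x in ballB r,
    |p x t - avgB r (fun y => p y t)| ^ ((3 : ℝ) / 2)

/-- The `j`-th spatial coordinate direction in space-time `ℝ³ × ℝ`. -/
def spaceDir (j : Fin 3) : E3 × ℝ := (EuclideanSpace.single j (1 : ℝ), 0)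

/-- The time direction in space-time `ℝ³ × ℝ`. -/
def timeDir : E3 × ℝ := (0, 1)

/-- The spatial Laplacian of a space-time test function. -/
def lapSpace (φ : E3 × ℝ → ℝ) (z : E3 × ℝ) : ℝ :=
  ∑ j, fderiv ℝ (fun w => fderiv ℝ φ w (spaceDir j)) z (spaceDir j)

/-- `gv` is the weak spatial gradient of `v` on `B(ϱ)`, for a.e. time in `(-ϱ², 0)`:
integration by parts against smooth test functions compactly supported in `B(ϱ)`. -/
def IsWeakSpatialGradient (v : E3 → ℝ → E3) (gv : E3 → ℝ → Fin 3 → Fin 3 → ℝ)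
    (ϱ : ℝ) : Prop :=
  ∀ᵐ t ∂(volume.restrict (timeI ϱ)),
    ∀ φ : E3 → ℝ, ContDiff ℝ (⊤ : ℕ∞) φ → tsupport φ ⊆ ballB ϱ →
      ∀ i j, ∫ x in ballB ϱ, v x t i * fderiv ℝ φ x (EuclideanSpace.single j (1 : ℝ))
        = - ∫ x in ballB ϱ, gv x t i j * φ x

/-- The regularity class `v ∈ L_∞(-ϱ²,0;L₂(B(ϱ))) ∩ L₂(-ϱ²,0;W¹₂(B(ϱ)))`,
with weak spatial gradient `gv ∈ L₂(Q(ϱ))`. -/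
structure VelocityClass (v : E3 → ℝ → E3) (gv : E3 → ℝ → Fin 3 → Fin 3 → ℝ)
    (ϱ : ℝ) : Prop where
  v_meas : AEMeasurable (fun z : E3 × ℝ => v z.1 z.2) (volume.restrict (QSet ϱ))
  v_L2 : IntegrableOn (fun z : E3 × ℝ => ‖v z.1 z.2‖ ^ 2) (QSet ϱ)
  v_Linfty : ∃ M : ℝ, ∀ᵐ t ∂(volume.restrict (timeI ϱ)),
      (∫ x in ballB ϱ, ‖v x t‖ ^ 2) ≤ M
  grad_L2 : IntegrableOn (fun z : E3 × ℝ => ∑ i, ∑ j, (gv z.1 z.2 i j) ^ 2) (QSet ϱ)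
  isGrad : IsWeakSpatialGradient v gv ϱ

/-- The Navier–Stokes equations hold in `Q = Q(1)` in the sense of distributions. -/
def NSEDistrib (v : E3 → ℝ → E3) (gv : E3 → ℝ → Fin 3 → Fin 3 → ℝ)
    (p : E3 → ℝ → ℝ) : Prop :=
  (∀ φ : E3 × ℝ → E3, ContDiff ℝ (⊤ : ℕ∞) φ → tsupport φ ⊆ QSet 1 →
    (∫ z in QSet 1,
      ((∑ i, v z.1 z.2 i * fderiv ℝ (fun w => φ w i) z timeDir)
        + (∑ i, ∑ j, v z.1 z.2 i * v z.1 z.2 j * fderiv ℝ (fun w => φ w i) z (spaceDir j))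
        - (∑ i, ∑ j, gv z.1 z.2 i j * fderiv ℝ (fun w => φ w i) z (spaceDir j))
        + p z.1 z.2 * (∑ i, fderiv ℝ (fun w => φ w i) z (spaceDir i)))) = 0)
  ∧
  (∀ q : E3 × ℝ → ℝ, ContDiff ℝ (⊤ : ℕ∞) q → tsupport q ⊆ QSet 1 →
    (∫ z in QSet 1, ∑ i, v z.1 z.2 i * fderiv ℝ q z (spaceDir i)) = 0)

/-- The parabolic boundary of `Q = B(1) × (-1,0)`. -/
def parabBdry : Set (E3 × ℝ) :=
  (Metric.sphere (0 : E3) 1 ×ˢ Set.Icc (-1 : ℝ) 0)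
    ∪ (Metric.closedBall (0 : E3) 1 ×ˢ {(-1 : ℝ)})

/-- The local energy inequality for a suitable weak solution on `Q = Q(1)`. -/
def LocalEnergyIneq (v : E3 → ℝ → E3) (gv : E3 → ℝ → Fin 3 → Fin 3 → ℝ)
    (p : E3 → ℝ → ℝ) : Prop :=
  ∀ᵐ t ∂(volume.restrict (Set.Ioo (-1 : ℝ) 0)),
    ∀ φ : E3 × ℝ → ℝ, ContDiff ℝ (⊤ : ℕ∞) φ → (∀ z, 0 ≤ φ z) →
      (∃ U : Set (E3 × ℝ), IsOpen U ∧ parabBdry ⊆ U ∧ ∀ z ∈ U, φ z = 0) →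
      (∫ x in ballB 1, φ (x, t) * ‖v x t‖ ^ 2)
        + 2 * ∫ s in Set.Ioo (-1 : ℝ) t, ∫ x in ballB 1,
            φ (x, s) * ∑ i, ∑ j, (gv x s i j) ^ 2
      ≤ ∫ s in Set.Ioo (-1 : ℝ) t, ∫ x in ballB 1,
          (‖v x s‖ ^ 2 * (lapSpace φ (x, s) + fderiv ℝ φ (x, s) timeDir)
            + (∑ i, v x s i * fderiv ℝ φ (x, s) (spaceDir i)) * (‖v x s‖ ^ 2 + 2 * p x s))

/-- `(v, p)` is a suitable weak solution of the Navier–Stokes equations in `Q = Q(1)`,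
with `gv` the weak spatial gradient of `v`. -/
structure SuitableWeakSolution (v : E3 → ℝ → E3) (gv : E3 → ℝ → Fin 3 → Fin 3 → ℝ)
    (p : E3 → ℝ → ℝ) : Prop where
  vel : VelocityClass v gv 1
  p_meas : AEMeasurable (fun z : E3 × ℝ => p z.1 z.2) (volume.restrict (QSet 1))
  p_L32 : IntegrableOn (fun z : E3 × ℝ => |p z.1 z.2| ^ ((3 : ℝ) / 2)) (QSet 1)
  nse : NSEDistrib v gv p
  lei : LocalEnergyIneq v gv p

open scoped ENNReal NNReal Topology Convolution ContDiff
open Filter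

theorem E3.apply_self_eq_sum (L : E3 →L[ℝ] ℝ) (x : E3) :
    L x = ∑ i, x i * L (EuclideanSpace.single i (1 : ℝ)) := by
  conv_lhs => rw [← (EuclideanSpace.basisFun (Fin 3) ℝ).sum_repr x]
  simp [map_sum, map_smul]

theorem E3.norm_le_sum (L : E3 →L[ℝ] ℝ) :
    ‖L‖ ≤ ∑ i, |L (EuclideanSpace.single i (1 : ℝ))| := by
  refine L.opNorm_le_bound (Finset.sum_nonneg fun i _ => abs_nonneg _) fun x => ?_
  rw [E3.apply_self_eq_sum L x, Finset.sum_mul]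
  refine (norm_sum_le _ _).trans (Finset.sum_le_sum fun i _ => ?_)
  rw [norm_mul, mul_comm, Real.norm_eq_abs (L _)]
  exact mul_le_mul_of_nonneg_left (PiLp.norm_apply_le x i) (abs_nonneg _)

theorem integral_fderiv_apply_self {w : E3 → ℝ} (hw : ContDiff ℝ 1 w)
    (hc : HasCompactSupport w) :
    ∫ x, fderiv ℝ w x x = -3 * ∫ x, w x := by
  have hcont : Continuous (fderiv ℝ w) := hw.continuous_fderiv (by norm_num)
  have hcd : HasCompactSupport (fderiv ℝ w) := hc.fderiv ℝ
  have hcoord : ∀ i : Fin 3, Continuous fun x : E3 => x i := fun i => by fun_prop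
  have key : ∀ i : Fin 3,
      Integrable (fun x : E3 => x i * fderiv ℝ w x (EuclideanSpace.single i (1 : ℝ))) ∧
      ∫ x : E3, x i * fderiv ℝ w x (EuclideanSpace.single i (1 : ℝ)) = - ∫ x, w x := by
    intro i
    have hd : ∀ x : E3, HasFDerivAt (fun x : E3 => x i)
        (EuclideanSpace.proj i : E3 →L[ℝ] ℝ) x := fun x =>
      (EuclideanSpace.proj i : E3 →L[ℝ] ℝ).hasFDerivAt
    have hd1 : ∀ x : E3, fderiv ℝ (fun x : E3 => x i) x (EuclideanSpace.single i (1 : ℝ)) = 1 := by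
      intro x
      rw [(hd x).fderiv]; simp
    have h1 : Integrable (fun x : E3 => x i * fderiv ℝ w x (EuclideanSpace.single i (1 : ℝ))) := by
      refine Continuous.integrable_of_hasCompactSupport (by fun_prop) ?_
      refine HasCompactSupport.mul_left ?_
      exact hcd.mono fun x hx => by
        contrapose! hx
        simp only [Function.mem_support, not_not] at hx ⊢
        simp [hx]
    refine ⟨h1, ?_⟩
    rw [integral_mul_fderiv_eq_neg_fderiv_mul_of_integrable]
    · simp_rw [hd1, one_mul]
    · simp_rw [hd1, one_mul]
      exact hw.continuous.integrable_of_hasCompactSupport hc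
    · exact h1
    · exact ((hcoord i).mul hw.continuous).integrable_of_hasCompactSupport hc.mul_left
    · exact fun x _ => (hd x).differentiableAt
    · exact fun x _ => hw.differentiable (by norm_num) x
  simp_rw [fun x => E3.apply_self_eq_sum (fderiv ℝ w x) x]
  rw [integral_finsetSum _ fun i _ => (key i).1]
  simp_rw [fun i => (key i).2]
  simp

/-- A radial cutoff, equal to one where `‖x‖ ^ 2 ≤ 1 - 2 / k` and to zero where
`1 - 1 / k ≤ ‖x‖ ^ 2`. -/
def radialCutoff (k : ℝ) (x : E3) : ℝ := Real.smoothTransition (k * (1 - ‖x‖ ^ 2) - 1)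

theorem radialCutoff_nonneg (k : ℝ) (x : E3) : 0 ≤ radialCutoff k x :=
  Real.smoothTransition.nonneg _

theorem radialCutoff_le_one (k : ℝ) (x : E3) : radialCutoff k x ≤ 1 :=
  Real.smoothTransition.le_one _

theorem radialCutoff_contDiff (k : ℝ) {n : ℕ∞} : ContDiff ℝ n (radialCutoff k) := by
  unfold radialCutoff
  refine Real.smoothTransition.contDiff.comp ?_
  have := contDiff_norm_sq ℝ (E := E3) (n := n)
  fun_prop

theorem radialCutoff_eq_zero {k : ℝ} {x : E3} (h : k * (1 - ‖x‖ ^ 2) ≤ 1) :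
    radialCutoff k x = 0 :=
  Real.smoothTransition.zero_of_nonpos (by linarith)

theorem radialCutoff_eq_one {k : ℝ} {x : E3} (h : 2 ≤ k * (1 - ‖x‖ ^ 2)) :
    radialCutoff k x = 1 :=
  Real.smoothTransition.one_of_one_le (by linarith)

theorem radialCutoff_hasCompactSupport {k : ℝ} (hk : 0 < k) :
    HasCompactSupport (radialCutoff k) := by
  refine HasCompactSupport.of_support_subset_isCompact
    (isCompact_closedBall (0 : E3) 1) fun x hx => ?_
  rw [mem_closedBall_zero_iff]
  by_contra! h
  refine hx (radialCutoff_eq_zero ?_)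
  have h1 : 1 ≤ ‖x‖ ^ 2 := one_le_pow₀ h.le
  linarith [mul_nonneg hk.le (sub_nonneg.2 h1)]

theorem norm_fderiv_radialCutoff_le {k : ℝ} (hk : 4 ≤ k) (x : E3) :
    ‖fderiv ℝ (radialCutoff k) x‖ ≤ -2 * fderiv ℝ (radialCutoff k) x x := by
  set s := k * (1 - ‖x‖ ^ 2) - 1 with hs
  set m := deriv Real.smoothTransition s with hm
  have hm0 : 0 ≤ m := Real.smoothTransition.monotone.deriv_nonneg
  have h1 : HasDerivAt Real.smoothTransition m s :=
    ((Real.smoothTransition.contDiff (n := 1)).differentiable (by norm_num) s).hasDerivAt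
  have h2 : HasFDerivAt (fun x : E3 => k * (1 - ‖x‖ ^ 2) - 1)
      (-(k * 2) • (innerSL ℝ x)) x := by
    have h3 := (hasStrictFDerivAt_norm_sq x).hasFDerivAt
    refine (((h3.const_sub 1).const_mul k).sub_const 1).congr_fderiv ?_
    ext y
    simp
    ring
  have h4 : HasFDerivAt (radialCutoff k) (m • (-(k * 2) • (innerSL ℝ x))) x :=
    h1.comp_hasFDerivAt x h2
  rw [h4.fderiv]
  have hn : ‖m • (-(k * 2) • (innerSL ℝ x))‖ = m * (k * 2) * ‖x‖ := by
    rw [norm_smul, norm_smul, innerSL_apply_norm, Real.norm_of_nonneg hm0, norm_neg,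
      Real.norm_of_nonneg (by linarith)]
    ring
  have hv : (m • (-(k * 2) • (innerSL ℝ x))) x = - (m * (k * 2) * ‖x‖ ^ 2) := by
    simp
    ring
  rw [hn, hv]
  by_cases hx : 1 / 2 ≤ ‖x‖
  · have : 0 ≤ m * (k * 2) * ‖x‖ := by positivity
    nlinarith
  · push Not at hx
    have : m = 0 := by
      have hev : Real.smoothTransition =ᶠ[𝓝 s] fun _ => 1 := by
        have : 1 < s := by
          have h5 : ‖x‖ ^ 2 ≤ (1 / 2) ^ 2 := pow_le_pow_left₀ (norm_nonneg x) hx.le 2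
          have h6 : k * (3 / 4) ≤ k * (1 - ‖x‖ ^ 2) :=
            mul_le_mul_of_nonneg_left (by linarith) (by linarith)
          linarith
        filter_upwards [lt_mem_nhds this] with y hy
        exact Real.smoothTransition.one_of_one_le hy.le
      rw [hm, hev.deriv_eq]; simp
    simp [this]

/-- Constant in the Gagliardo-Nirenberg-Sobolev inequality `W¹₁ ⊆ L_{3/2}` on `ℝ³`. -/
def gnsConst : ℝ≥0 := eLpNormLESNormFDerivOneConst (volume : Measure E3) ((3 / 2 : ℝ≥0) : ℝ)

theorem eLpNorm_radialCutoff_mul_sq_le {k : ℝ} (hk : 4 ≤ k) {u : E3 → ℝ} (hu : ContDiff ℝ 1 u) :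
    eLpNorm (fun x => radialCutoff k x * u x ^ 2) ((3 / 2 : ℝ≥0) : ℝ≥0∞) volume ≤
      gnsConst * ENNReal.ofReal
        (6 * ∫ x, radialCutoff k x * (u x ^ 2 + |u x| * ‖fderiv ℝ u x‖)) := by
  set η := radialCutoff k with hη
  set w : E3 → ℝ := fun x => η x * u x ^ 2 with hw
  have hηc : ContDiff ℝ 1 η := radialCutoff_contDiff k
  have hηs : HasCompactSupport η := radialCutoff_hasCompactSupport (by linarith)
  have hη0 : ∀ x, 0 ≤ η x := radialCutoff_nonneg k
  have hwc : ContDiff ℝ 1 w := hηc.mul (hu.pow 2)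
  have hws : HasCompactSupport w := hηs.mul_right
  have hcd : Continuous (fderiv ℝ w) := hwc.continuous_fderiv (by norm_num)
  have hcu : Continuous (fderiv ℝ u) := hu.continuous_fderiv (by norm_num)
  have hcη : Continuous (fderiv ℝ η) := hηc.continuous_fderiv (by norm_num)
  have cη := hηc.continuous
  have cu := hu.continuous
  have hD : ∀ x, fderiv ℝ w x = u x ^ 2 • fderiv ℝ η x + (2 * η x * u x) • fderiv ℝ u x := by
    intro x
    have h1 := (hηc.differentiable (by norm_num) x).hasFDerivAt
    have h2 := (hu.differentiable (by norm_num) x).hasFDerivAt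
    have h3 : HasFDerivAt w _ x := h1.mul (h2.pow 2)
    rw [h3.fderiv]
    ext y
    simp
    ring
  have hηds : HasCompactSupport (fderiv ℝ η) := hηs.fderiv ℝ
  have i1 : Integrable (fun x => u x ^ 2 * fderiv ℝ η x x) := by
    refine Continuous.integrable_of_hasCompactSupport (by fun_prop) ?_
    refine HasCompactSupport.mul_left (hηds.mono fun x hx => ?_)
    contrapose! hx
    simp only [Function.mem_support, not_not] at hx ⊢
    simp [hx]
  have i2 : Integrable (fun x => η x * (u x ^ 2 + |u x| * ‖fderiv ℝ u x‖)) :=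
    Continuous.integrable_of_hasCompactSupport (by fun_prop) hηs.mul_right
  have i3 : Integrable (fun x => η x * (u x * fderiv ℝ u x x)) :=
    Continuous.integrable_of_hasCompactSupport (by fun_prop) hηs.mul_right
  have i4 : Integrable w := hwc.continuous.integrable_of_hasCompactSupport hws
  have i5 : Integrable (fun x => ‖fderiv ℝ w x‖) :=
    (Continuous.integrable_of_hasCompactSupport hcd (hws.fderiv ℝ)).norm
  have hdiv := integral_fderiv_apply_self hwc hws
  have hflux : -∫ x, u x ^ 2 * fderiv ℝ η x x
      = 3 * (∫ x, w x) + 2 * ∫ x, η x * (u x * fderiv ℝ u x x) := by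
    have : ∫ x, fderiv ℝ w x x
        = (∫ x, u x ^ 2 * fderiv ℝ η x x) + 2 * ∫ x, η x * (u x * fderiv ℝ u x x) := by
      rw [← integral_const_mul, ← integral_add i1 (i3.const_mul 2)]
      refine integral_congr_ae (Eventually.of_forall fun x => ?_)
      simp [hD]; ring
    linarith
  have hbound : ∫ x, ‖fderiv ℝ w x‖ ≤ 6 * ∫ x, η x * (u x ^ 2 + |u x| * ‖fderiv ℝ u x‖) := by
    have hpt : ∀ x, ‖fderiv ℝ w x‖ ≤
        -2 * (u x ^ 2 * fderiv ℝ η x x) + 2 * (η x * (|u x| * ‖fderiv ℝ u x‖)) := by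
      intro x
      rw [hD]
      refine (norm_add_le _ _).trans ?_
      rw [norm_smul, norm_smul, Real.norm_of_nonneg (sq_nonneg _), norm_mul, norm_mul,
        Real.norm_of_nonneg (hη0 x), Real.norm_eq_abs (u x)]
      have := mul_le_mul_of_nonneg_left (norm_fderiv_radialCutoff_le hk x) (sq_nonneg (u x))
      norm_num
      linarith
    have i6 : Integrable (fun x => η x * (|u x| * ‖fderiv ℝ u x‖)) :=
      Continuous.integrable_of_hasCompactSupport (by fun_prop) hηs.mul_right
    have hmono := integral_mono i5 ((i1.const_mul (-2)).add (i6.const_mul 2)) hpt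
    rw [integral_add' (i1.const_mul (-2)) (i6.const_mul 2), integral_const_mul,
      integral_const_mul] at hmono
    have hsup : ∫ x, η x * (u x * fderiv ℝ u x x) ≤ ∫ x, η x * (|u x| * ‖fderiv ℝ u x‖) := by
      refine integral_mono i3 i6 fun x => ?_
      by_cases hx : ‖x‖ ≤ 1
      · refine mul_le_mul_of_nonneg_left ?_ (hη0 x)
        calc u x * fderiv ℝ u x x ≤ |u x * fderiv ℝ u x x| := le_abs_self _
          _ = |u x| * ‖fderiv ℝ u x x‖ := abs_mul _ _
          _ ≤ |u x| * ‖fderiv ℝ u x‖ := by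
            refine mul_le_mul_of_nonneg_left ?_ (abs_nonneg _)
            refine ((fderiv ℝ u x).le_opNorm x).trans ?_
            exact mul_le_of_le_one_right (norm_nonneg _) hx
      · have : η x = 0 := radialCutoff_eq_zero (by
          have h1 : 1 ≤ ‖x‖ ^ 2 := one_le_pow₀ (not_le.1 hx).le
          linarith [mul_nonneg (by linarith : 0 ≤ k) (sub_nonneg.2 h1)])
        simp [this]
    have hsplit : ∫ x, η x * (u x ^ 2 + |u x| * ‖fderiv ℝ u x‖)
        = (∫ x, w x) + ∫ x, η x * (|u x| * ‖fderiv ℝ u x‖) := by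
      rw [← integral_add i4 i6]
      refine integral_congr_ae (Eventually.of_forall fun x => ?_)
      simp [hw]; ring
    rw [hsplit]
    linarith
  have hgns := eLpNorm_le_eLpNorm_fderiv_one (volume : Measure E3) hwc hws (p := 3 / 2) (by
    rw [NNReal.holderConjugate_iff, finrank_euclideanSpace_fin]
    constructor
    · norm_num
    · ext; norm_num)
  refine hgns.trans ?_
  unfold gnsConst
  gcongr
  rw [eLpNorm_one_eq_lintegral_enorm, ← ofReal_integral_norm_eq_lintegral_enorm
    (Continuous.integrable_of_hasCompactSupport hcd (hws.fderiv ℝ))]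
  exact ENNReal.ofReal_le_ofReal hbound

theorem lintegral_enorm_sq_convolution_bump_le (ρ : ContDiffBump (0 : E3)) {f : E3 → ℝ}
    (hf : AEStronglyMeasurable f volume) :
    ∫⁻ x, ‖(f ⋆[ContinuousLinearMap.lsmul ℝ ℝ] ρ.normed volume) x‖ₑ ^ 2 ≤ ∫⁻ x, ‖f x‖ₑ ^ 2 := by
  set a : E3 → ℝ≥0∞ := fun x => ‖ρ.normed volume x‖ₑ with ha
  have cρ : Continuous (ρ.normed (volume : Measure E3)) := ρ.continuous_normed
  have ma : Measurable a := cρ.measurable.enorm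
  have a1 : ∫⁻ x, a x = 1 := by
    rw [ha, ← ofReal_integral_norm_eq_lintegral_enorm
      (cρ.integrable_of_hasCompactSupport ρ.hasCompactSupport_normed)]
    simp_rw [Real.norm_of_nonneg (ρ.nonneg_normed _)]
    rw [ρ.integral_normed]; simp
  have mf : AEMeasurable (fun x => ‖f x‖ₑ) volume := hf.enorm
  have hpt : ∀ x, ‖(f ⋆[ContinuousLinearMap.lsmul ℝ ℝ] ρ.normed volume) x‖ₑ ^ 2
      ≤ ∫⁻ t, ‖f t‖ₑ ^ 2 * a (x - t) := by
    intro x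
    have max : Measurable fun t => a (x - t) := ma.comp (measurable_const.sub measurable_id)
    have a1x : ∫⁻ t, a (x - t) = 1 := by rw [lintegral_sub_left_eq_self a x, a1]
    have h1 : ‖(f ⋆[ContinuousLinearMap.lsmul ℝ ℝ] ρ.normed volume) x‖ₑ
        ≤ ∫⁻ t, ‖f t‖ₑ * a (x - t) := by
      rw [convolution_def]
      refine (enorm_integral_le_lintegral_enorm _).trans (le_of_eq ?_)
      refine lintegral_congr fun t => ?_
      simp [ha, enorm_mul]
    have h2 : ∫⁻ t, ‖f t‖ₑ * a (x - t) ≤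
        (∫⁻ t, ‖f t‖ₑ ^ 2 * a (x - t)) ^ (1 / 2 : ℝ) := by
      have := ENNReal.lintegral_mul_le_Lp_mul_Lq (volume : Measure E3) Real.HolderConjugate.two_two
        (f := fun t => ‖f t‖ₑ * a (x - t) ^ (1 / 2 : ℝ)) (g := fun t => a (x - t) ^ (1 / 2 : ℝ))
        (mf.mul (max.pow_const _).aemeasurable) (max.pow_const _).aemeasurable
      have hs : ∀ y : ℝ≥0∞, y ^ (1 / 2 : ℝ) * y ^ (1 / 2 : ℝ) = y := fun y => by
        rw [← ENNReal.rpow_add_of_nonneg _ _ (by norm_num) (by norm_num)]; norm_num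
      have hs2 : ∀ y : ℝ≥0∞, (y ^ (1 / 2 : ℝ)) ^ (2 : ℝ) = y := fun y => by
        rw [← ENNReal.rpow_mul]; norm_num
      simp only [Pi.mul_apply, mul_assoc, hs, hs2, a1x, ENNReal.one_rpow, mul_one,
        ENNReal.mul_rpow_of_nonneg _ _ zero_le_two, ENNReal.rpow_two] at this
      simpa [hs, hs2] using this
    calc _ ≤ ((∫⁻ t, ‖f t‖ₑ ^ 2 * a (x - t)) ^ (1 / 2 : ℝ)) ^ 2 := by
          gcongr; exact h1.trans h2
      _ = _ := by rw [← ENNReal.rpow_two, ← ENNReal.rpow_mul]; norm_num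
  refine (lintegral_mono hpt).trans ?_
  rw [lintegral_lintegral_swap]
  · refine le_of_eq (lintegral_congr fun t => ?_)
    have mat : Measurable fun x => a (x - t) := ma.comp (measurable_id.sub measurable_const)
    rw [lintegral_const_mul _ mat,
      lintegral_sub_right_eq_self a t, a1, mul_one]
  · have m1 : AEMeasurable (fun z : E3 × E3 => ‖f z.2‖ₑ ^ 2) (volume.prod volume) :=
      (mf.pow_const 2).comp_quasiMeasurePreserving Measure.quasiMeasurePreserving_snd
    have m2 : AEMeasurable (fun z : E3 × E3 => a (z.1 - z.2)) (volume.prod volume) :=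
      (ma.comp (measurable_fst.sub measurable_snd)).aemeasurable
    exact m1.mul m2

theorem integral_sq_eq_toReal_lintegral {α : Type*} [MeasurableSpace α] {μ : Measure α}
    {f : α → ℝ} (hf : AEStronglyMeasurable f μ) :
    ∫ x, f x ^ 2 ∂μ = (∫⁻ x, ‖f x‖ₑ ^ 2 ∂μ).toReal := by
  rw [integral_eq_lintegral_of_nonneg_ae (Eventually.of_forall fun x => sq_nonneg _) (hf.pow 2)]
  congr 1
  refine lintegral_congr fun x => ?_
  rw [← sq_abs, ← Real.norm_eq_abs, ENNReal.ofReal_pow (norm_nonneg _), ofReal_norm]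

theorem memLp_two_iff_lintegral {α : Type*} [MeasurableSpace α] {μ : Measure α}
    {f : α → ℝ} (hf : AEStronglyMeasurable f μ) :
    MemLp f 2 μ ↔ ∫⁻ x, ‖f x‖ₑ ^ 2 ∂μ < ⊤ := by
  have := eLpNorm_lt_top_iff_lintegral_rpow_enorm_lt_top (p := 2) (μ := μ) (f := f)
    (by norm_num) (by norm_num)
  simp only [ENNReal.toReal_ofNat, ENNReal.rpow_two] at this
  exact ⟨fun h => this.1 h.2, fun h => ⟨hf, this.2 h⟩⟩

theorem contDiff_convolution_bump (ρ : ContDiffBump (0 : E3)) {f : E3 → ℝ}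
    (hf : MemLp f 2 volume) {n : ℕ∞} :
    ContDiff ℝ n (f ⋆[ContinuousLinearMap.lsmul ℝ ℝ] ρ.normed volume) :=
  ρ.hasCompactSupport_normed.contDiff_convolution_right _ (hf.locallyIntegrable (by norm_num))
    ρ.contDiff_normed

theorem memLp_convolution_bump (ρ : ContDiffBump (0 : E3)) {f : E3 → ℝ}
    (hf : MemLp f 2 volume) :
    MemLp (f ⋆[ContinuousLinearMap.lsmul ℝ ℝ] ρ.normed volume) 2 volume :=
  (memLp_two_iff_lintegral
    (contDiff_convolution_bump ρ hf (n := 0)).continuous.aestronglyMeasurable).2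
    ((lintegral_enorm_sq_convolution_bump_le ρ hf.1).trans_lt
      ((memLp_two_iff_lintegral hf.1).1 hf))

theorem integral_sq_convolution_bump_le (ρ : ContDiffBump (0 : E3)) {f : E3 → ℝ}
    (hf : MemLp f 2 volume) :
    ∫ x, (f ⋆[ContinuousLinearMap.lsmul ℝ ℝ] ρ.normed volume) x ^ 2 ≤ ∫ x, f x ^ 2 := by
  rw [integral_sq_eq_toReal_lintegral hf.1,
    integral_sq_eq_toReal_lintegral (memLp_convolution_bump ρ hf).1]
  exact ENNReal.toReal_mono ((memLp_two_iff_lintegral hf.1).1 hf).ne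
    (lintegral_enorm_sq_convolution_bump_le ρ hf.1)

theorem integral_abs_mul_le_sqrt_mul_sqrt {α : Type*} [MeasurableSpace α] {μ : Measure α}
    {f g : α → ℝ} (hf : MemLp f 2 μ) (hg : MemLp g 2 μ) :
    ∫ x, |f x| * |g x| ∂μ ≤ √(∫ x, f x ^ 2 ∂μ) * √(∫ x, g x ^ 2 ∂μ) := by
  have h2 : ENNReal.ofReal 2 = 2 := by norm_num
  have := integral_mul_le_Lp_mul_Lq_of_nonneg (μ := μ) Real.HolderConjugate.two_two
    (f := fun x => |f x|) (g := fun x => |g x|)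
    (Eventually.of_forall fun x => abs_nonneg _) (Eventually.of_forall fun x => abs_nonneg _)
    (by rw [h2]; exact hf.abs) (by rw [h2]; exact hg.abs)
  simpa [Real.sqrt_eq_rpow] using this

theorem norm_fderiv_convolution_bump_le (ρ : ContDiffBump (0 : E3)) {u G : E3 → ℝ}
    (hu : MemLp u 2 (volume.restrict (ballB 1)))
    (hweak : ∀ φ : E3 → ℝ, ContDiff ℝ (⊤ : ℕ∞) φ → tsupport φ ⊆ ballB 1 → ∀ j : Fin 3,
      |∫ x in ballB 1, u x * fderiv ℝ φ x (EuclideanSpace.single j (1 : ℝ))|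
        ≤ ∫ x in ballB 1, G x * |φ x|)
    {x : E3} (hx : ‖x‖ + ρ.rOut < 1) :
    ‖fderiv ℝ ((ballB 1).indicator u ⋆[ContinuousLinearMap.lsmul ℝ ℝ] ρ.normed volume) x‖
      ≤ 3 * ((ballB 1).indicator G ⋆[ContinuousLinearMap.lsmul ℝ ℝ] ρ.normed volume) x := by
  have hB : MeasurableSet (ballB 1) := measurableSet_ball
  have hu0 : MemLp ((ballB 1).indicator u) 2 volume := (memLp_indicator_iff_restrict hB).2 hu
  have hloc : LocallyIntegrable ((ballB 1).indicator u) volume :=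
    hu0.locallyIntegrable (by norm_num)
  set φ : E3 → ℝ := fun y => ρ.normed volume (x - y) with hφ
  have hφc : ContDiff ℝ (⊤ : ℕ∞) φ := ρ.contDiff_normed.comp (contDiff_const.sub contDiff_id)
  have hφs : tsupport φ ⊆ ballB 1 := by
    have h1 : tsupport φ ⊆ closedBall x ρ.rOut := by
      refine closure_minimal (fun y hy => ?_) isClosed_closedBall
      have : x - y ∈ Function.support (ρ.normed volume) := hy
      rw [ρ.support_normed_eq, mem_ball_zero_iff] at this
      rw [mem_closedBall, dist_comm, dist_eq_norm]
      exact this.le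
    refine h1.trans fun y hy => ?_
    rw [mem_closedBall, dist_eq_norm] at hy
    rw [ballB, mem_ball_zero_iff]
    have : ‖y‖ ≤ ‖y - x‖ + ‖x‖ := by simpa using norm_add_le (y - x) x
    linarith
  have hcd : Continuous (fderiv ℝ (ρ.normed (volume : Measure E3))) :=
    (ρ.contDiff_normed (n := 1)).continuous_fderiv (by norm_num)
  have hj : ∀ j : Fin 3,
      |fderiv ℝ ((ballB 1).indicator u ⋆[ContinuousLinearMap.lsmul ℝ ℝ] ρ.normed volume) x
        (EuclideanSpace.single j (1 : ℝ))|
      ≤ ((ballB 1).indicator G ⋆[ContinuousLinearMap.lsmul ℝ ℝ] ρ.normed volume) x := by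
    intro j
    rw [(ρ.hasCompactSupport_normed.hasFDerivAt_convolution_right
      (ContinuousLinearMap.lsmul ℝ ℝ) hloc ρ.contDiff_normed x).fderiv,
      convolution_precompR_apply _ hloc (ρ.hasCompactSupport_normed.fderiv ℝ) hcd,
      convolution_def, convolution_def]
    have hd : ∀ y, fderiv ℝ φ y (EuclideanSpace.single j (1 : ℝ))
        = - fderiv ℝ (ρ.normed volume) (x - y) (EuclideanSpace.single j (1 : ℝ)) := by
      intro y
      have h1 := ((ρ.contDiff_normed (n := 1) (μ := (volume : Measure E3))).differentiable
        (by norm_num) (x - y)).hasFDerivAt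
      have h2 : HasFDerivAt φ _ y := h1.comp y ((hasFDerivAt_id y).const_sub x)
      rw [h2.fderiv]; simp
    have := hweak φ hφc hφs j
    rw [← integral_indicator hB, ← integral_indicator hB] at this
    convert this using 1
    · rw [← abs_neg, ← integral_neg]
      congr 2
      ext y
      by_cases hy : y ∈ ballB 1 <;> simp [hy, hd]
    · congr 1
      ext y
      by_cases hy : y ∈ ballB 1 <;> simp [hy, hφ, abs_of_nonneg (ρ.nonneg_normed _)]
  refine (E3.norm_le_sum _).trans ((Finset.sum_le_sum fun j _ => hj j).trans ?_)
  simp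

/-- A function in `L₂` of the unit ball with weak gradient controlled by `G ∈ L₂` has square in
`L_{3/2}` of the unit ball. -/
theorem eLpNorm_sq_le_of_weak_gradient {u G : E3 → ℝ}
    (hu : MemLp u 2 (volume.restrict (ballB 1))) (hG : MemLp G 2 (volume.restrict (ballB 1)))
    (hG0 : ∀ x, 0 ≤ G x)
    (hweak : ∀ φ : E3 → ℝ, ContDiff ℝ (⊤ : ℕ∞) φ → tsupport φ ⊆ ballB 1 → ∀ j : Fin 3,
      |∫ x in ballB 1, u x * fderiv ℝ φ x (EuclideanSpace.single j (1 : ℝ))|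
        ≤ ∫ x in ballB 1, G x * |φ x|) :
    eLpNorm (fun x => u x ^ 2) ((3 / 2 : ℝ≥0) : ℝ≥0∞) (volume.restrict (ballB 1)) ≤
      gnsConst * ENNReal.ofReal (6 * ((∫ x in ballB 1, u x ^ 2) +
        3 * (√(∫ x in ballB 1, u x ^ 2) * √(∫ x in ballB 1, G x ^ 2)))) := by
  have hB : MeasurableSet (ballB 1) := measurableSet_ball
  set u0 := (ballB 1).indicator u with hu0d
  set G0 := (ballB 1).indicator G with hG0d
  have hu0 : MemLp u0 2 volume := (memLp_indicator_iff_restrict hB).2 hu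
  have hG1 : MemLp G0 2 volume := (memLp_indicator_iff_restrict hB).2 hG
  have sq_ind : ∀ f : E3 → ℝ, ∫ x in ballB 1, f x ^ 2 = ∫ x, (ballB 1).indicator f x ^ 2 := by
    intro f
    rw [← integral_indicator hB]
    congr 1
    ext y
    by_cases hy : y ∈ ballB 1 <;> simp [hy]
  rw [sq_ind u, sq_ind G, ← hu0d, ← hG0d]
  have kpos : ∀ n : ℕ, (0 : ℝ) < n + 4 := fun n => by positivity
  let ρ : ℕ → ContDiffBump (0 : E3) := fun n =>
    ⟨1 / (8 * (n + 4)), 1 / (4 * (n + 4)), by positivity, by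
      rw [div_lt_div_iff₀ (by positivity) (by positivity)]; linarith [kpos n]⟩
  let U : ℕ → E3 → ℝ := fun n => u0 ⋆[ContinuousLinearMap.lsmul ℝ ℝ] (ρ n).normed volume
  let g : ℕ → E3 → ℝ := fun n => G0 ⋆[ContinuousLinearMap.lsmul ℝ ℝ] (ρ n).normed volume
  have hUc : ∀ n, ContDiff ℝ 1 (U n) := fun n => contDiff_convolution_bump (ρ n) hu0
  have hU2 : ∀ n, MemLp (U n) 2 volume := fun n => memLp_convolution_bump (ρ n) hu0
  have hg2 : ∀ n, MemLp (g n) 2 volume := fun n => memLp_convolution_bump (ρ n) hG1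
  have hg0 : ∀ n x, 0 ≤ g n x := fun n x => by
    refine integral_nonneg fun t => ?_
    simp only [ContinuousLinearMap.lsmul_apply, smul_eq_mul]
    exact mul_nonneg (indicator_nonneg (fun y _ => hG0 y) t) ((ρ n).nonneg_normed _)
  have hbound : ∀ n : ℕ, eLpNorm (fun x => radialCutoff (n + 4) x * U n x ^ 2)
      ((3 / 2 : ℝ≥0) : ℝ≥0∞) volume ≤ gnsConst * ENNReal.ofReal (6 * ((∫ x, u0 x ^ 2) +
        3 * (√(∫ x, u0 x ^ 2) * √(∫ x, G0 x ^ 2)))) := by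
    intro n
    refine (eLpNorm_radialCutoff_mul_sq_le (by linarith [n.cast_nonneg (α := ℝ)]) (hUc n)).trans ?_
    gcongr
    have iU : Integrable (fun x => U n x ^ 2) := (hU2 n).integrable_sq
    have iUg : Integrable (fun x => |U n x| * |g n x|) := (hU2 n).abs.integrable_mul (hg2 n).abs
    calc ∫ x, radialCutoff (n + 4) x * (U n x ^ 2 + |U n x| * ‖fderiv ℝ (U n) x‖)
        ≤ ∫ x, (U n x ^ 2 + 3 * (|U n x| * |g n x|)) := by
          refine integral_mono_of_nonneg (Eventually.of_forall fun x => ?_)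
            (iU.add (iUg.const_mul 3)) (Eventually.of_forall fun x => ?_)
          · exact mul_nonneg (radialCutoff_nonneg _ _) (by positivity)
          · by_cases hx : ((n : ℝ) + 4) * (1 - ‖x‖ ^ 2) ≤ 1
            · simp only [radialCutoff_eq_zero hx, zero_mul]
              positivity
            · have hx1 : ‖x‖ + (ρ n).rOut < 1 := by
                push Not at hx
                have e : (ρ n).rOut = 1 / (4 * (n + 4)) := rfl
                rw [e]
                set q := 1 / (4 * ((n : ℝ) + 4)) with hq
                have hq0 : 0 < q := by positivity
                have hq1 : ((n : ℝ) + 4) * (4 * q) = 1 := by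
                  rw [hq]; field_simp
                have : 4 * q < 1 - ‖x‖ ^ 2 :=
                  lt_of_mul_lt_mul_left (by linarith) (kpos n).le
                nlinarith [norm_nonneg x]
              have hD : ‖fderiv ℝ (U n) x‖ ≤ 3 * g n x :=
                norm_fderiv_convolution_bump_le (ρ n) hu hweak hx1
              have h0 : 0 ≤ U n x ^ 2 + |U n x| * ‖fderiv ℝ (U n) x‖ := by positivity
              refine (mul_le_of_le_one_left h0 (radialCutoff_le_one _ _)).trans ?_
              beta_reduce
              rw [abs_of_nonneg (hg0 n x)]
              have := mul_le_mul_of_nonneg_left hD (abs_nonneg (U n x))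
              linarith
      _ = (∫ x, U n x ^ 2) + 3 * ∫ x, |U n x| * |g n x| := by
          rw [integral_add iU (iUg.const_mul 3), integral_const_mul]
      _ ≤ _ := by
          have h1 := integral_sq_convolution_bump_le (ρ n) hu0
          have h2 := integral_sq_convolution_bump_le (ρ n) hG1
          have h3 := integral_abs_mul_le_sqrt_mul_sqrt (hU2 n) (hg2 n)
          have h4 : √(∫ x, U n x ^ 2) * √(∫ x, g n x ^ 2) ≤
              √(∫ x, u0 x ^ 2) * √(∫ x, G0 x ^ 2) := by gcongr
          linarith
  have hlim : ∀ᵐ x ∂(volume.restrict (ballB 1)), Tendsto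
      (fun n : ℕ => radialCutoff (n + 4) x * U n x ^ 2) atTop (𝓝 (u x ^ 2)) := by
    have hconv := ContDiffBump.ae_convolution_tendsto_right_of_locallyIntegrable
      (μ := (volume : Measure E3)) (φ := ρ) (l := atTop) (K := 2) (g := u0) (by
        have h1 : Tendsto (fun n : ℕ => (1 / 4 : ℝ) / (((n + 4 : ℕ)) : ℝ)) atTop (𝓝 0) :=
          (tendsto_const_div_atTop_nhds_zero_nat (1 / 4 : ℝ)).comp (tendsto_add_atTop_nat 4)
        refine h1.congr fun n => ?_
        change _ = 1 / (4 * ((n : ℝ) + 4))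
        push_cast
        field_simp) (Eventually.of_forall fun n => by
        change 1 / (4 * ((n : ℝ) + 4)) ≤ 2 * (1 / (8 * ((n : ℝ) + 4)))
        apply le_of_eq
        have := (kpos n).ne'
        field_simp; norm_num) (hu0.locallyIntegrable (by norm_num))
    rw [ae_restrict_iff' hB]
    filter_upwards [hconv] with x hx hxB
    have hxu : u0 x = u x := indicator_of_mem hxB u
    have hU : Tendsto (fun n => U n x) atTop (𝓝 (u x)) := by
      rw [← hxu]
      refine hx.congr fun n => ?_
      rw [convolution_eq_swap]
      refine integral_congr_ae (Eventually.of_forall fun t => ?_)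
      simp [mul_comm]
    have hη : Tendsto (fun n : ℕ => radialCutoff (n + 4) x) atTop (𝓝 1) := by
      refine tendsto_const_nhds.congr' ?_
      have hx1 : 0 < 1 - ‖x‖ ^ 2 := by
        rw [ballB, mem_ball_zero_iff] at hxB
        nlinarith [norm_nonneg x]
      have : Tendsto (fun n : ℕ => ((n : ℝ) + 4) * (1 - ‖x‖ ^ 2)) atTop atTop :=
        (tendsto_atTop_add_const_right _ _ tendsto_natCast_atTop_atTop).atTop_mul_const hx1
      filter_upwards [this.eventually_ge_atTop 2] with n hn
      exact (radialCutoff_eq_one hn).symm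
    simpa using hη.mul (hU.pow 2)
  refine (Lp.eLpNorm_lim_le_liminf_eLpNorm (fun n => ?_) _ hlim).trans ?_
  · exact (((radialCutoff_contDiff _ (n := 0)).continuous.mul
      ((hUc n).continuous.pow 2)).aestronglyMeasurable)
  · refine liminf_le_of_le (by isBoundedDefault) fun b hb => ?_
    obtain ⟨n, hn⟩ := hb.exists
    exact hn.trans ((eLpNorm_restrict_le _ _ _ _).trans (hbound n))

theorem restrict_QSet (R : ℝ) : (volume : Measure (E3 × ℝ)).restrict (QSet R) =
    (volume.restrict (ballB R)).prod (volume.restrict (timeI R)) := by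
  rw [Measure.prod_restrict]; rfl

theorem QSet_subset {r R : ℝ} (hr : 0 ≤ r) (h : r ≤ R) : QSet r ⊆ QSet R :=
  prod_mono (ball_subset_ball h) (Ioo_subset_Ioo_left (by nlinarith))

instance (R : ℝ) : IsFiniteMeasure ((volume : Measure E3).restrict (ballB R)) :=
  ⟨by rw [Measure.restrict_apply_univ]; exact measure_ball_lt_top⟩

instance (R : ℝ) : IsFiniteMeasure ((volume : Measure ℝ).restrict (timeI R)) :=
  ⟨by rw [Measure.restrict_apply_univ]; exact measure_Ioo_lt_top⟩

theorem ae_aestronglyMeasurable_slice {α β F : Type*} [MeasurableSpace α] [MeasurableSpace β]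
    [NormedAddCommGroup F] {μ : Measure α} {ν : Measure β} [SFinite μ] [SFinite ν]
    {f : α × β → F} (hf : AEStronglyMeasurable f (μ.prod ν)) :
    ∀ᵐ y ∂ν, AEStronglyMeasurable (fun x => f (x, y)) μ :=
  hf.prod_swap.prodMk_left

theorem lintegral_enorm_cube_le_of_weak_gradient {u G : E3 → ℝ}
    (hu : MemLp u 2 (volume.restrict (ballB 1))) (hG : MemLp G 2 (volume.restrict (ballB 1)))
    (hG0 : ∀ x, 0 ≤ G x)
    (hweak : ∀ φ : E3 → ℝ, ContDiff ℝ (⊤ : ℕ∞) φ → tsupport φ ⊆ ballB 1 → ∀ j : Fin 3,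
      |∫ x in ballB 1, u x * fderiv ℝ φ x (EuclideanSpace.single j (1 : ℝ))|
        ≤ ∫ x in ballB 1, G x * |φ x|)
    {M : ℝ} (hM : ∫ x in ballB 1, u x ^ 2 ≤ M) :
    ∫⁻ x in ballB 1, ‖u x‖ₑ ^ 3 ≤
      (gnsConst * ENNReal.ofReal (6 * (M + 3 * √M))) ^ (3 / 2 : ℝ) *
        ENNReal.ofReal (2 + 2 * ∫ x in ballB 1, G x ^ 2) := by
  have h := eLpNorm_sq_le_of_weak_gradient hu hG hG0 hweak
  set a := ∫ x in ballB 1, u x ^ 2 with ha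
  set b := ∫ x in ballB 1, G x ^ 2 with hb
  have ha0 : 0 ≤ a := integral_nonneg fun x => sq_nonneg _
  have hb0 : 0 ≤ b := integral_nonneg fun x => sq_nonneg _
  have hM0 : 0 ≤ M := ha0.trans hM
  have hreal : 6 * (a + 3 * (√a * √b)) ≤ 6 * (M + 3 * √M) * (1 + √b) := by
    have h1 : √a * √b ≤ √M * √b := by gcongr
    have h2 : 0 ≤ M * √b := by positivity
    have h3 : 0 ≤ √M := by positivity
    nlinarith
  have h32 : ((3 / 2 : ℝ≥0) : ℝ) = 3 / 2 := by norm_num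
  have key : ∫⁻ x in ballB 1, ‖u x‖ₑ ^ 3 =
      eLpNorm (fun x => u x ^ 2) ((3 / 2 : ℝ≥0) : ℝ≥0∞) (volume.restrict (ballB 1))
        ^ (3 / 2 : ℝ) := by
    have := eLpNorm_nnreal_pow_eq_lintegral (p := (3 / 2 : ℝ≥0)) (f := fun x => u x ^ 2)
      (μ := volume.restrict (ballB 1)) (by norm_num)
    rw [h32] at this
    rw [this]
    refine lintegral_congr fun x => ?_
    rw [enorm_pow, ← ENNReal.rpow_two, ← ENNReal.rpow_mul]
    norm_num
  rw [key]
  calc _ ≤ (gnsConst * (ENNReal.ofReal (6 * (M + 3 * √M)) * ENNReal.ofReal (1 + √b)))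
        ^ (3 / 2 : ℝ) := by
        gcongr
        refine h.trans ?_
        gcongr
        rw [← ENNReal.ofReal_mul (by positivity)]
        exact ENNReal.ofReal_le_ofReal hreal
    _ ≤ _ := by
        rw [← mul_assoc, ENNReal.mul_rpow_of_nonneg _ _ (by norm_num)]
        gcongr
        rw [ENNReal.ofReal_rpow_of_nonneg (by positivity) (by norm_num)]
        refine ENNReal.ofReal_le_ofReal ?_
        calc (1 + √b) ^ (3 / 2 : ℝ) ≤ (1 + √b) ^ (2 : ℝ) :=
              Real.rpow_le_rpow_of_exponent_le (by linarith [Real.sqrt_nonneg b]) (by norm_num)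
          _ = (1 + √b) ^ 2 := Real.rpow_two _
          _ ≤ _ := by nlinarith [Real.sq_sqrt hb0, sq_nonneg (1 - √b)]

theorem E3.norm_cube_le (y : E3) : ‖y‖ ^ 3 ≤ 16 * ∑ i, |y i| ^ 3 := by
  have h1 : ‖y‖ ≤ |y 0| + (|y 1| + |y 2|) := by
    rw [EuclideanSpace.norm_eq, Fin.sum_univ_three]
    refine Real.sqrt_le_iff.2 ⟨by positivity, ?_⟩
    simp only [Real.norm_eq_abs]
    have := abs_nonneg (y 0); have := abs_nonneg (y 1); have := abs_nonneg (y 2)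
    have : 0 ≤ |y 0| * |y 1| := by positivity
    have : 0 ≤ |y 0| * |y 2| := by positivity
    have : 0 ≤ |y 1| * |y 2| := by positivity
    nlinarith
  have h2 := add_pow_le (abs_nonneg (y 0)) (by positivity : 0 ≤ |y 1| + |y 2|) 3
  have h3 := add_pow_le (abs_nonneg (y 1)) (abs_nonneg (y 2)) 3
  have h4 := pow_le_pow_left₀ (norm_nonneg y) h1 3
  have h5 : 0 ≤ |y 0| ^ 3 := by positivity
  rw [Fin.sum_univ_three]
  norm_num at h2 h3
  linarith

theorem E3.abs_apply_le (y : E3) (i : Fin 3) : |y i| ≤ ‖y‖ := PiLp.norm_apply_le y i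

namespace VelocityClass

variable {v : E3 → ℝ → E3} {gv : E3 → ℝ → Fin 3 → Fin 3 → ℝ}

theorem aestronglyMeasurable_apply (h : VelocityClass v gv 1) (i : Fin 3) :
    AEStronglyMeasurable (fun z : E3 × ℝ => v z.1 z.2 i) (volume.restrict (QSet 1)) :=
  (EuclideanSpace.proj i : E3 →L[ℝ] ℝ).continuous.comp_aestronglyMeasurable
    h.v_meas.aestronglyMeasurable

theorem ae_memLp_apply (h : VelocityClass v gv 1) (i : Fin 3) :
    ∀ᵐ t ∂(volume.restrict (timeI 1)),
      MemLp (fun x => v x t i) 2 (volume.restrict (ballB 1)) := by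
  have h1 := h.aestronglyMeasurable_apply i
  have h2 : Integrable _ _ := h.v_L2
  rw [restrict_QSet] at h1 h2
  filter_upwards [ae_aestronglyMeasurable_slice h1, h2.prod_left_ae] with t ht1 ht2
  refine (memLp_two_iff_integrable_sq ht1).2 (ht2.mono' (ht1.pow 2) (Eventually.of_forall ?_))
  intro x
  rw [norm_pow, Real.norm_eq_abs]
  exact pow_le_pow_left₀ (abs_nonneg _) (E3.abs_apply_le _ _) 2

theorem ae_lintegral_cube_le (h : VelocityClass v gv 1) (i : Fin 3) :
    ∃ K : ℝ≥0∞, K ≠ ⊤ ∧ ∀ᵐ t ∂(volume.restrict (timeI 1)),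
      ∫⁻ x in ballB 1, ‖v x t i‖ₑ ^ 3 ≤
        K * ENNReal.ofReal (2 + 2 * ∫ x in ballB 1, ∑ i, ∑ j, (gv x t i j) ^ 2) := by
  obtain ⟨M, hM⟩ := h.v_Linfty
  refine ⟨(gnsConst * ENNReal.ofReal (6 * (M + 3 * √M))) ^ (3 / 2 : ℝ),
    ENNReal.rpow_ne_top_of_nonneg (by norm_num)
      (ENNReal.mul_ne_top ENNReal.coe_ne_top ENNReal.ofReal_ne_top), ?_⟩
  have h2 : Integrable _ _ := h.v_L2
  have h3 : Integrable _ _ := h.grad_L2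
  rw [restrict_QSet] at h2 h3
  filter_upwards [hM, h.ae_memLp_apply i, h2.prod_left_ae, h3.prod_left_ae, h.isGrad]
    with t htM hu hv2 hg2 hgrad
  have hS0 : ∀ x, 0 ≤ ∑ i, ∑ j, (gv x t i j) ^ 2 := fun x =>
    Finset.sum_nonneg fun i _ => Finset.sum_nonneg fun j _ => sq_nonneg _
  set G : E3 → ℝ := fun x => √(∑ i, ∑ j, (gv x t i j) ^ 2) with hGd
  have hGsq : ∀ x, G x ^ 2 = ∑ i, ∑ j, (gv x t i j) ^ 2 := fun x => Real.sq_sqrt (hS0 x)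
  have hGm : AEStronglyMeasurable G (volume.restrict (ballB 1)) :=
    Real.continuous_sqrt.comp_aestronglyMeasurable hg2.1
  have hG : MemLp G 2 (volume.restrict (ballB 1)) := by
    rw [memLp_two_iff_integrable_sq hGm]
    simp_rw [hGsq]
    exact hg2
  have hle : ∀ x i j, |gv x t i j| ≤ G x := fun x i j => by
    refine Real.abs_le_sqrt ?_
    refine (Finset.single_le_sum (f := fun j => gv x t i j ^ 2) (fun j _ => sq_nonneg _)
      (Finset.mem_univ j)).trans ?_
    exact Finset.single_le_sum (f := fun i => ∑ j, gv x t i j ^ 2)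
      (fun i _ => Finset.sum_nonneg fun j _ => sq_nonneg _) (Finset.mem_univ i)
  have := lintegral_enorm_cube_le_of_weak_gradient hu hG (fun x => Real.sqrt_nonneg _) ?_ (M := M) ?_
  · simp_rw [hGsq] at this
    exact this
  · intro φ hφ hs j
    rw [hgrad φ hφ hs i j, abs_neg, ← Real.norm_eq_abs]
    have hφs : HasCompactSupport φ := by
      refine HasCompactSupport.of_support_subset_isCompact (isCompact_closedBall (0 : E3) 1) ?_
      exact (subset_tsupport φ).trans (hs.trans ball_subset_closedBall)
    obtain ⟨C, hC⟩ := hφs.exists_bound_of_continuous hφ.continuous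
    refine norm_integral_le_of_norm_le ?_ (Eventually.of_forall fun x => ?_)
    · refine (hG.integrable (by norm_num)).mul_bdd (c := C)
        hφ.continuous.abs.aestronglyMeasurable (Eventually.of_forall fun x => ?_)
      simpa using hC x
    · rw [norm_mul]
      exact mul_le_mul_of_nonneg_right (hle x i j) (abs_nonneg _)
  · refine (integral_mono hu.integrable_sq hv2 fun x => ?_).trans htM
    change v x t i ^ 2 ≤ ‖v x t‖ ^ 2
    rw [← sq_abs]
    exact pow_le_pow_left₀ (abs_nonneg _) (E3.abs_apply_le _ _) 2

/-- Velocity fields of finite energy on the unit cylinder are in `L₃`. -/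
theorem integrableOn_norm_cube (h : VelocityClass v gv 1) :
    IntegrableOn (fun z : E3 × ℝ => ‖v z.1 z.2‖ ^ 3) (QSet 1) := by
  have hi : ∀ i, Integrable (fun z : E3 × ℝ => |v z.1 z.2 i| ^ 3) (volume.restrict (QSet 1)) := by
    intro i
    have hm := h.aestronglyMeasurable_apply i
    refine ⟨(continuous_abs.pow 3).comp_aestronglyMeasurable hm, ?_⟩
    have h3 : Integrable _ _ := h.grad_L2
    obtain ⟨K, hK, hb⟩ := h.ae_lintegral_cube_le i
    rw [restrict_QSet] at hm h3 ⊢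
    rw [hasFiniteIntegral_iff_enorm]
    have e : ∀ z : E3 × ℝ, ‖|v z.1 z.2 i| ^ 3‖ₑ = ‖v z.1 z.2 i‖ₑ ^ 3 := fun z => by
      rw [enorm_pow, ← Real.norm_eq_abs, enorm_norm]
    simp_rw [e]
    rw [lintegral_prod_symm _ (hm.enorm.pow_const 3)]
    refine (lintegral_mono_ae hb).trans_lt ?_
    rw [lintegral_const_mul' _ _ hK]
    refine ENNReal.mul_lt_top hK.lt_top ?_
    have hb1 := h3.integral_prod_right
    have hb2 : Integrable (fun t => 2 + 2 * ∫ x in ballB 1, ∑ i, ∑ j, (gv x t i j) ^ 2)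
        (volume.restrict (timeI 1)) := (integrable_const 2).add (hb1.const_mul 2)
    exact hb2.lintegral_lt_top
  refine ((integrable_finsetSum Finset.univ fun i _ => hi i).const_mul 16).mono'
    (h.v_meas.aestronglyMeasurable.norm.pow 3) (Eventually.of_forall fun z => ?_)
  rw [norm_pow, norm_norm]
  exact E3.norm_cube_le _

end VelocityClass

theorem rpow_three_halves_add_le {a b : ℝ} (ha : 0 ≤ a) (hb : 0 ≤ b) :
    (a + b) ^ (3 / 2 : ℝ) ≤ 2 * (a ^ (3 / 2 : ℝ) + b ^ (3 / 2 : ℝ)) := by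
  have h : (a + b) ^ (3 / 2 : ℝ) ≤
      2 ^ ((3 / 2 : ℝ) - 1) * (a ^ (3 / 2 : ℝ) + b ^ (3 / 2 : ℝ)) := by
    lift a to ℝ≥0 using ha
    lift b to ℝ≥0 using hb
    exact_mod_cast NNReal.rpow_add_le_mul_rpow_add_rpow a b (by norm_num : (1 : ℝ) ≤ 3 / 2)
  refine h.trans ?_
  have : (2 : ℝ) ^ ((3 / 2 : ℝ) - 1) ≤ 2 ^ (1 : ℝ) :=
    Real.rpow_le_rpow_of_exponent_le (by norm_num) (by norm_num)
  rw [Real.rpow_one] at this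
  gcongr

theorem mul_le_cube_add_rpow_three_halves {a b : ℝ} (ha : 0 ≤ a) (hb : 0 ≤ b) :
    a * b ≤ a ^ 3 + b ^ (3 / 2 : ℝ) := by
  have h := Real.young_inequality_of_nonneg ha hb
    (Real.holderConjugate_iff.2 ⟨by norm_num, by norm_num⟩ : (3 : ℝ).HolderConjugate (3 / 2))
  have h3 : a ^ (3 : ℝ) = a ^ 3 := by exact_mod_cast Real.rpow_natCast a 3
  have h4 : 0 ≤ a ^ 3 := by positivity
  have h5 : 0 ≤ b ^ (3 / 2 : ℝ) := by positivity
  rw [h3] at h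
  linarith

section Average

variable {α : Type*} [MeasurableSpace α] {μ : Measure α} [IsFiniteMeasure μ] {f : α → ℝ}

theorem integrable_abs_sub_const_rpow (hf : AEStronglyMeasurable f μ)
    (hi : Integrable (fun x => |f x| ^ (3 / 2 : ℝ)) μ) (c : ℝ) :
    Integrable (fun x => |f x - c| ^ (3 / 2 : ℝ)) μ := by
  have hcont : Continuous fun y : ℝ => |y - c| ^ (3 / 2 : ℝ) :=
    (continuous_abs.comp (continuous_id.sub continuous_const)).rpow_const fun _ =>
      Or.inr (by norm_num)
  refine ((hi.add (integrable_const (|c| ^ (3 / 2 : ℝ)))).const_mul 2).mono'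
    (hcont.comp_aestronglyMeasurable hf) (Eventually.of_forall fun x => ?_)
  rw [Real.norm_of_nonneg (by positivity)]
  refine le_trans ?_ (rpow_three_halves_add_le (abs_nonneg (f x)) (abs_nonneg c))
  exact Real.rpow_le_rpow (abs_nonneg _) (abs_sub _ _) (by norm_num)

/-- Up to a factor, the mean value minimizes the `L_{3/2}` distance to constants. -/
theorem integral_abs_sub_average_rpow_le (hf : AEStronglyMeasurable f μ)
    (hi : Integrable (fun x => |f x| ^ (3 / 2 : ℝ)) μ) (c : ℝ) :
    ∫ x, |f x - ⨍ y, f y ∂μ| ^ (3 / 2 : ℝ) ∂μ ≤ 4 * ∫ x, |f x - c| ^ (3 / 2 : ℝ) ∂μ := by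
  rcases eq_or_ne μ 0 with rfl | hμ
  · simp
  have : NeZero μ := ⟨hμ⟩
  have hfi : Integrable f μ := by
    refine ((integrable_const (1 : ℝ)).add hi).mono' hf (Eventually.of_forall fun x => ?_)
    have := mul_le_cube_add_rpow_three_halves zero_le_one (abs_nonneg (f x))
    simpa using this
  have hic := integrable_abs_sub_const_rpow hf hi c
  set m := ⨍ y, f y ∂μ with hm
  have hconv : ConvexOn ℝ univ fun y : ℝ => |y - c| ^ (3 / 2 : ℝ) := by
    have h1 : ConvexOn ℝ univ fun y : ℝ => |y - c| := by
      have := (convexOn_norm (E := ℝ) convex_univ).translate_left (-c)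
      simpa [Function.comp_def, sub_eq_add_neg, Real.norm_eq_abs] using this
    refine ⟨convex_univ, fun x _ y _ a b ha hb hab => ?_⟩
    have h2 := h1.2 (mem_univ x) (mem_univ y) ha hb hab
    refine (Real.rpow_le_rpow (abs_nonneg _) h2 (by norm_num)).trans ?_
    exact (convexOn_rpow (by norm_num : (1 : ℝ) ≤ 3 / 2)).2 (mem_Ici.2 (abs_nonneg (x - c)))
      (mem_Ici.2 (abs_nonneg (y - c))) ha hb hab
  have hcont : Continuous fun y : ℝ => |y - c| ^ (3 / 2 : ℝ) :=
    (continuous_abs.comp (continuous_id.sub continuous_const)).rpow_const fun _ =>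
      Or.inr (by norm_num)
  have hjensen : |m - c| ^ (3 / 2 : ℝ) ≤ ⨍ x, |f x - c| ^ (3 / 2 : ℝ) ∂μ :=
    hconv.map_average_le hcont.continuousOn isClosed_univ (by simp) hfi hic
  have hpos : 0 < μ.real univ := measureReal_univ_pos
  have hconst : ∫ _ : α, |m - c| ^ (3 / 2 : ℝ) ∂μ ≤ ∫ x, |f x - c| ^ (3 / 2 : ℝ) ∂μ := by
    rw [integral_const, smul_eq_mul]
    rw [average_eq, smul_eq_mul] at hjensen
    calc _ ≤ μ.real univ * ((μ.real univ)⁻¹ * ∫ x, |f x - c| ^ (3 / 2 : ℝ) ∂μ) := by gcongr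
      _ = _ := by field_simp
  calc ∫ x, |f x - m| ^ (3 / 2 : ℝ) ∂μ
      ≤ ∫ x, 2 * (|f x - c| ^ (3 / 2 : ℝ) + |m - c| ^ (3 / 2 : ℝ)) ∂μ := by
        refine integral_mono (integrable_abs_sub_const_rpow hf hi m)
          ((hic.add (integrable_const _)).const_mul 2) fun x => ?_
        refine le_trans ?_ (rpow_three_halves_add_le (abs_nonneg (f x - c)) (abs_nonneg (m - c)))
        refine Real.rpow_le_rpow (abs_nonneg _) ?_ (by norm_num)
        have := abs_sub (f x - c) (m - c)
        rwa [sub_sub_sub_cancel_right] at this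
    _ = 2 * ((∫ x, |f x - c| ^ (3 / 2 : ℝ) ∂μ) + ∫ _ : α, |m - c| ^ (3 / 2 : ℝ) ∂μ) := by
        rw [integral_const_mul, integral_add hic (integrable_const _)]
    _ ≤ _ := by linarith

end Average

/-- The spatial integral in the definition of `D₀`, at one time. -/
def pressureOsc (p : E3 → ℝ → ℝ) (r t : ℝ) : ℝ :=
  ∫ x in ballB r, |p x t - avgB r (fun y => p y t)| ^ (3 / 2 : ℝ)

theorem pressureOsc_nonneg (p : E3 → ℝ → ℝ) (r t : ℝ) : 0 ≤ pressureOsc p r t :=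
  integral_nonneg fun _ => by positivity

section Pressure

variable {p : E3 → ℝ → ℝ} {R : ℝ}

theorem ae_slice_pressure
    (hm : AEStronglyMeasurable (fun z : E3 × ℝ => p z.1 z.2) (volume.restrict (QSet R)))
    (hi : IntegrableOn (fun z : E3 × ℝ => |p z.1 z.2| ^ (3 / 2 : ℝ)) (QSet R)) :
    ∀ᵐ t ∂(volume.restrict (timeI R)),
      AEStronglyMeasurable (fun x => p x t) (volume.restrict (ballB R)) ∧
      Integrable (fun x => |p x t| ^ (3 / 2 : ℝ)) (volume.restrict (ballB R)) := by
  have hi' : Integrable _ _ := hi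
  rw [restrict_QSet] at hm hi'
  filter_upwards [ae_aestronglyMeasurable_slice hm, hi'.prod_left_ae] with t h1 h2
  exact ⟨h1, h2⟩

theorem integrable_pressureOsc
    (hm : AEStronglyMeasurable (fun z : E3 × ℝ => p z.1 z.2) (volume.restrict (QSet R)))
    (hi : IntegrableOn (fun z : E3 × ℝ => |p z.1 z.2| ^ (3 / 2 : ℝ)) (QSet R)) :
    IntegrableOn (pressureOsc p R) (timeI R) := by
  have hs := ae_slice_pressure hm hi
  have hi' : Integrable _ _ := hi
  rw [restrict_QSet] at hm hi'
  have hcont : Continuous fun y : ℝ => |y| ^ (3 / 2 : ℝ) :=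
    continuous_abs.rpow_const fun _ => Or.inr (by norm_num)
  have havg : AEStronglyMeasurable (fun t => avgB R (fun y => p y t))
      (volume.restrict (timeI R)) := by
    have h0 : AEStronglyMeasurable (fun t => ∫ x in ballB R, p x t) (volume.restrict (timeI R)) :=
      hm.prod_swap.integral_prod_right'
    simp only [avgB, average_eq, smul_eq_mul]
    exact aestronglyMeasurable_const.mul h0
  have hmeas : AEStronglyMeasurable (pressureOsc p R) (volume.restrict (timeI R)) := by
    have h1 : AEStronglyMeasurable
        (fun z : ℝ × E3 => |p z.2 z.1 - avgB R (fun y => p y z.1)| ^ (3 / 2 : ℝ))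
        ((volume.restrict (timeI R)).prod (volume.restrict (ballB R))) :=
      hcont.comp_aestronglyMeasurable (hm.prod_swap.sub havg.comp_fst)
    exact h1.integral_prod_right'
  refine (hi'.integral_prod_right.const_mul 4).mono' hmeas ?_
  filter_upwards [hs] with t ht
  rw [Real.norm_of_nonneg (pressureOsc_nonneg p R t)]
  simpa [pressureOsc, avgB] using integral_abs_sub_average_rpow_le ht.1 ht.2 0

theorem funD0_le_of_le {r : ℝ} (hr : 0 < r) (hrR : r ≤ R)
    (hm : AEStronglyMeasurable (fun z : E3 × ℝ => p z.1 z.2) (volume.restrict (QSet R)))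
    (hi : IntegrableOn (fun z : E3 × ℝ => |p z.1 z.2| ^ (3 / 2 : ℝ)) (QSet R)) :
    funD0 p r ≤ 4 * (R / r) ^ 2 * funD0 p R := by
  have hR : 0 < R := hr.trans_le hrR
  have hsub : timeI r ⊆ timeI R := Ioo_subset_Ioo_left (by nlinarith)
  have hbsub : ballB r ⊆ ballB R := ball_subset_ball hrR
  have hI := integrable_pressureOsc hm hi
  have hslice := ae_slice_pressure hm hi
  have h1 : ∫ t in timeI r, pressureOsc p r t ≤ ∫ t in timeI r, 4 * pressureOsc p R t := by
    refine integral_mono_of_nonneg (Eventually.of_forall fun t => pressureOsc_nonneg p r t)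
      ((hI.mono_set hsub).const_mul 4) ?_
    filter_upwards [ae_restrict_of_ae_restrict_of_subset hsub hslice] with t ht
    have hmr : AEStronglyMeasurable (fun x => p x t) (volume.restrict (ballB r)) :=
      ht.1.mono_measure (Measure.restrict_mono_set _ hbsub)
    have hir : IntegrableOn (fun x => |p x t| ^ (3 / 2 : ℝ)) (ballB R) := ht.2
    refine (integral_abs_sub_average_rpow_le hmr (hir.mono_set hbsub)
      (avgB R (fun y => p y t))).trans ?_
    refine mul_le_mul_of_nonneg_left ?_ (by norm_num)
    exact setIntegral_mono_set (integrable_abs_sub_const_rpow ht.1 ht.2 _)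
      (Eventually.of_forall fun x => by positivity) hbsub.eventuallyLE
  have h2 : ∫ t in timeI r, pressureOsc p R t ≤ ∫ t in timeI R, pressureOsc p R t :=
    setIntegral_mono_set hI (Eventually.of_forall fun t => pressureOsc_nonneg p R t)
      hsub.eventuallyLE
  rw [integral_const_mul] at h1
  have e : 4 * (R / r) ^ 2 * funD0 p R = (1 / r ^ 2) * (4 * ∫ t in timeI R, pressureOsc p R t) := by
    simp only [funD0, pressureOsc]
    field_simp
  rw [e]
  change (1 / r ^ 2) * ∫ t in timeI r, pressureOsc p r t ≤ _
  gcongr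
  linarith

end Pressure

theorem hasFDerivAt_mul_fst_snd {ψ : E3 → ℝ} {θ : ℝ → ℝ} {z : E3 × ℝ}
    (hψ : DifferentiableAt ℝ ψ z.1) (hθ : DifferentiableAt ℝ θ z.2) :
    HasFDerivAt (fun w : E3 × ℝ => ψ w.1 * θ w.2)
      (ψ z.1 • (fderiv ℝ θ z.2).comp (ContinuousLinearMap.snd ℝ E3 ℝ) +
        θ z.2 • (fderiv ℝ ψ z.1).comp (ContinuousLinearMap.fst ℝ E3 ℝ)) z :=
  (hψ.hasFDerivAt.comp z hasFDerivAt_fst).mul (hθ.hasFDerivAt.comp z hasFDerivAt_snd)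

theorem fderiv_mul_spaceDir {ψ : E3 → ℝ} {θ : ℝ → ℝ} (hψ : Differentiable ℝ ψ)
    (hθ : Differentiable ℝ θ) (z : E3 × ℝ) (j : Fin 3) :
    fderiv ℝ (fun w : E3 × ℝ => ψ w.1 * θ w.2) z (spaceDir j) =
      fderiv ℝ ψ z.1 (EuclideanSpace.single j (1 : ℝ)) * θ z.2 := by
  rw [(hasFDerivAt_mul_fst_snd (hψ z.1) (hθ z.2)).fderiv]
  simp [spaceDir, mul_comm]

theorem fderiv_mul_timeDir {ψ : E3 → ℝ} {θ : ℝ → ℝ} (hψ : Differentiable ℝ ψ)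
    (hθ : Differentiable ℝ θ) (z : E3 × ℝ) :
    fderiv ℝ (fun w : E3 × ℝ => ψ w.1 * θ w.2) z timeDir = ψ z.1 * deriv θ z.2 := by
  rw [(hasFDerivAt_mul_fst_snd (hψ z.1) (hθ z.2)).fderiv]
  simp [timeDir]

theorem lapSpace_mul {ψ : E3 → ℝ} {θ : ℝ → ℝ} (hψ : ContDiff ℝ 2 ψ)
    (hθ : Differentiable ℝ θ) (z : E3 × ℝ) :
    lapSpace (fun w : E3 × ℝ => ψ w.1 * θ w.2) z =
      (∑ j, fderiv ℝ (fun y => fderiv ℝ ψ y (EuclideanSpace.single j (1 : ℝ))) z.1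
        (EuclideanSpace.single j (1 : ℝ))) * θ z.2 := by
  rw [lapSpace, Finset.sum_mul]
  refine Finset.sum_congr rfl fun j _ => ?_
  have h1 : Differentiable ℝ fun y => fderiv ℝ ψ y (EuclideanSpace.single j (1 : ℝ)) :=
    ((hψ.fderiv_right (m := 1) (by norm_num)).clm_apply contDiff_const).differentiable
      (by norm_num)
  have h2 : (fun w => fderiv ℝ (fun w : E3 × ℝ => ψ w.1 * θ w.2) w (spaceDir j)) =
      fun w : E3 × ℝ => (fun y => fderiv ℝ ψ y (EuclideanSpace.single j (1 : ℝ))) w.1 * θ w.2 :=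
    funext fun w => fderiv_mul_spaceDir (hψ.differentiable (by norm_num)) hθ w j
  rw [h2, fderiv_mul_spaceDir h1 hθ]

namespace SuitableWeakSolution

variable {v : E3 → ℝ → E3} {gv : E3 → ℝ → Fin 3 → Fin 3 → ℝ} {p : E3 → ℝ → ℝ}

/-- The velocity is divergence free at almost every time. -/
theorem ae_integral_velocity_gradient_eq_zero (h : SuitableWeakSolution v gv p) {ψ : E3 → ℝ}
    (hψ : ContDiff ℝ (⊤ : ℕ∞) ψ) (hs : tsupport ψ ⊆ ballB 1) :
    ∀ᵐ t ∂(volume.restrict (timeI 1)),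
      ∫ x in ballB 1, ∑ i, v x t i * fderiv ℝ ψ x (EuclideanSpace.single i (1 : ℝ)) = 0 := by
  have hψs : HasCompactSupport ψ :=
    HasCompactSupport.of_support_subset_isCompact (isCompact_closedBall (0 : E3) 1)
      ((subset_tsupport ψ).trans (hs.trans ball_subset_closedBall))
  have hcd : Continuous (fderiv ℝ ψ) := hψ.continuous_fderiv (by simp)
  obtain ⟨C, hC⟩ := (hψs.fderiv ℝ).exists_bound_of_continuous hcd
  set F : E3 × ℝ → ℝ := fun z =>
    ∑ i, v z.1 z.2 i * fderiv ℝ ψ z.1 (EuclideanSpace.single i (1 : ℝ)) with hF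
  have hFi : Integrable F (volume.restrict (QSet 1)) := by
    refine integrable_finsetSum _ fun i _ => ?_
    have hvi : Integrable (fun z : E3 × ℝ => v z.1 z.2 i) (volume.restrict (QSet 1)) := by
      have : IsFiniteMeasure ((volume : Measure (E3 × ℝ)).restrict (QSet 1)) := by
        rw [restrict_QSet]; infer_instance
      have h2 : MemLp (fun z : E3 × ℝ => v z.1 z.2 i) 2 (volume.restrict (QSet 1)) := by
        have hm := h.vel.aestronglyMeasurable_apply i
        refine (memLp_two_iff_integrable_sq hm).2 (h.vel.v_L2.mono' (hm.pow 2)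
          (Eventually.of_forall fun z => ?_))
        rw [norm_pow, Real.norm_eq_abs]
        exact pow_le_pow_left₀ (abs_nonneg _) (E3.abs_apply_le _ _) 2
      exact h2.integrable (by norm_num)
    refine hvi.mul_bdd (c := C) (Continuous.aestronglyMeasurable (by fun_prop))
      (Eventually.of_forall fun z => ?_)
    refine ((fderiv ℝ ψ z.1).le_opNorm _).trans ?_
    simpa using hC z.1
  have hFp := hFi
  rw [restrict_QSet] at hFp
  have hFint := hFp.integral_prod_right
  have hms : MeasurableSet (timeI 1) := measurableSet_Ioo
  have hop : IsOpen (timeI 1) := isOpen_Ioo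
  rw [ae_restrict_iff' hms]
  refine hop.ae_eq_zero_of_integral_contDiff_smul_eq_zero 
    (IntegrableOn.locallyIntegrableOn hFint) fun g hg hgc hgs => ?_
  have hq := h.nse.2 (fun z => ψ z.1 * g z.2)
    ((hψ.comp contDiff_fst).mul (hg.comp contDiff_snd)) (by
      have : tsupport (fun z : E3 × ℝ => ψ z.1 * g z.2) ⊆ tsupport ψ ×ˢ tsupport g := by
        refine closure_minimal (fun z hz => ?_) ((isClosed_tsupport _).prod (isClosed_tsupport _))
        have hz' : ψ z.1 * g z.2 ≠ 0 := hz
        exact ⟨subset_tsupport _ (left_ne_zero_of_mul hz'),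
          subset_tsupport _ (right_ne_zero_of_mul hz')⟩
      exact this.trans (prod_mono hs hgs))
  have hd1 : Differentiable ℝ ψ := hψ.differentiable (by simp)
  have hd2 : Differentiable ℝ g := hg.differentiable (by simp)
  have e1 : ∀ z : E3 × ℝ, ∑ i, v z.1 z.2 i *
      fderiv ℝ (fun w : E3 × ℝ => ψ w.1 * g w.2) z (spaceDir i) = F z * g z.2 := by
    intro z
    rw [hF, Finset.sum_mul]
    refine Finset.sum_congr rfl fun i _ => ?_
    rw [fderiv_mul_spaceDir hd1 hd2]; ring
  simp_rw [e1] at hq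
  obtain ⟨C', hC'⟩ := hgc.exists_bound_of_continuous hg.continuous
  have hFg : Integrable (fun z : E3 × ℝ => F z * g z.2)
      ((volume.restrict (ballB 1)).prod (volume.restrict (timeI 1))) :=
    hFp.mul_bdd (c := C') (hg.continuous.comp continuous_snd).aestronglyMeasurable
      (Eventually.of_forall fun z => hC' z.2)
  rw [restrict_QSet, integral_prod_symm _ hFg] at hq
  rw [← hq, ← setIntegral_eq_integral_of_forall_compl_eq_zero (s := timeI 1)]
  · refine integral_congr_ae (Eventually.of_forall fun t => ?_)
    simp only [smul_eq_mul]
    rw [mul_comm, integral_mul_const]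
  · intro t ht
    have : g t = 0 := image_eq_zero_of_notMem_tsupport fun h' => ht (hgs h')
    simp [this]

end SuitableWeakSolution

/-- Spatial cut-off functions with the natural scaling of their derivatives. -/
theorem exists_spatial_cutoff : ∃ K : ℝ, 0 < K ∧ ∀ r : ℝ, 0 < r → ∃ ψ : E3 → ℝ,
    ContDiff ℝ (⊤ : ℕ∞) ψ ∧ (∀ x, 0 ≤ ψ x) ∧ (∀ x, ψ x ≤ 1) ∧ (∀ x ∈ ballB r, ψ x = 1) ∧
    tsupport ψ ⊆ closedBall 0 (3 / 2 * r) ∧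
    (∀ j x, |fderiv ℝ ψ x (EuclideanSpace.single j (1 : ℝ))| ≤ K / r) ∧
    (∀ j x, |fderiv ℝ (fun y => fderiv ℝ ψ y (EuclideanSpace.single j (1 : ℝ))) x
      (EuclideanSpace.single j (1 : ℝ))| ≤ K / r ^ 2) := by
  let χ : ContDiffBump (0 : E3) := ⟨1, 3 / 2, by norm_num, by norm_num⟩
  have hχ : ContDiff ℝ (⊤ : ℕ∞) χ := χ.contDiff
  let G : Fin 3 → E3 → ℝ := fun j y => fderiv ℝ χ y (EuclideanSpace.single j (1 : ℝ))
  have hG : ∀ j, ContDiff ℝ (⊤ : ℕ∞) (G j) := fun j =>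
    (hχ.fderiv_right (m := (⊤ : ℕ∞)) (by simp)).clm_apply contDiff_const
  have hGs : ∀ j, HasCompactSupport (G j) := fun j => χ.hasCompactSupport.fderiv_apply ℝ _
  obtain ⟨K₁, hK₁⟩ : ∃ K, ∀ j x, |G j x| ≤ K := by
    choose K hK using fun j => (hGs j).exists_bound_of_continuous (hG j).continuous
    exact ⟨∑ j, |K j|, fun j x => (hK j x).trans ((le_abs_self _).trans
      (Finset.single_le_sum (f := fun j => |K j|) (fun _ _ => abs_nonneg _) (Finset.mem_univ j)))⟩
  obtain ⟨K₂, hK₂⟩ : ∃ K, ∀ j x, |fderiv ℝ (G j) x (EuclideanSpace.single j (1 : ℝ))| ≤ K := by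
    choose K hK using fun j => ((hGs j).fderiv_apply ℝ
      (EuclideanSpace.single j (1 : ℝ))).exists_bound_of_continuous
        (((hG j).continuous_fderiv (by simp)).clm_apply continuous_const)
    exact ⟨∑ j, |K j|, fun j x => (hK j x).trans ((le_abs_self _).trans
      (Finset.single_le_sum (f := fun j => |K j|) (fun _ _ => abs_nonneg _) (Finset.mem_univ j)))⟩
  refine ⟨max 1 (max K₁ K₂), by positivity, fun r hr => ⟨fun x => χ (r⁻¹ • x),
    hχ.comp (contDiff_const_smul _), fun x => χ.nonneg, fun x => χ.le_one, fun x hx => ?_, ?_, ?_,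
    ?_⟩⟩
  · refine χ.one_of_mem_closedBall ?_
    have hx' : ‖x‖ < r := by simpa [ballB] using hx
    rw [mem_closedBall_zero_iff, norm_smul, Real.norm_of_nonneg (by positivity), inv_mul_le_iff₀ hr]
    simpa [χ] using hx'.le
  · refine closure_minimal (fun x hx => ?_) isClosed_closedBall
    have hx' : r⁻¹ • x ∈ Function.support χ := hx
    rw [χ.support_eq, mem_ball_zero_iff, norm_smul, Real.norm_of_nonneg (by positivity),
      inv_mul_lt_iff₀ hr] at hx'
    rw [mem_closedBall_zero_iff]
    simpa [χ, mul_comm] using hx'.le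
  · intro j x
    rw [fderiv_comp_smul]
    have h := hK₁ j (r⁻¹ • x)
    rw [smul_apply, smul_eq_mul, abs_mul, abs_of_pos (inv_pos.2 hr), div_eq_inv_mul]
    gcongr
    exact h.trans ((le_max_left _ _).trans (le_max_right _ _))
  · intro j x
    have e : (fun y => fderiv ℝ (fun x => χ (r⁻¹ • x)) y (EuclideanSpace.single j (1 : ℝ))) =
        r⁻¹ • fun y => G j (r⁻¹ • y) := by
      funext y
      rw [fderiv_comp_smul]
      rfl
    have hd : Differentiable ℝ (G j) := (hG j).differentiable (by simp)
    have hd' : DifferentiableAt ℝ (fun y => G j (r⁻¹ • y)) x :=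
      hd.differentiableAt.comp x (differentiableAt_id.const_smul r⁻¹)
    rw [e, fderiv_const_smul hd', fderiv_comp_smul]
    have h := hK₂ j (r⁻¹ • x)
    rw [smul_apply, smul_apply, smul_eq_mul, smul_eq_mul, ← mul_assoc, abs_mul,
      abs_of_pos (by positivity), div_eq_inv_mul, sq, mul_inv]
    gcongr
    exact h.trans ((le_max_right _ _).trans (le_max_right _ _))

theorem exists_abs_deriv_smoothTransition_le :
    ∃ K : ℝ, ∀ x, |deriv Real.smoothTransition x| ≤ K := by
  have hc : Continuous (deriv Real.smoothTransition) :=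
    (Real.smoothTransition.contDiff (n := 1)).continuous_deriv le_rfl
  obtain ⟨K, hK⟩ := isCompact_Icc.exists_bound_of_continuousOn
    (s := Icc (0 : ℝ) 1) hc.continuousOn
  refine ⟨max K 0, fun x => ?_⟩
  rcases lt_or_ge x 0 with h0 | h0
  · have : Real.smoothTransition =ᶠ[𝓝 x] fun _ => 0 := by
      filter_upwards [Iio_mem_nhds h0] with y hy
      exact Real.smoothTransition.zero_of_nonpos (le_of_lt hy)
    rw [this.deriv_eq]; simp
  rcases lt_or_ge 1 x with h1 | h1
  · have : Real.smoothTransition =ᶠ[𝓝 x] fun _ => 1 := by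
      filter_upwards [Ioi_mem_nhds h1] with y hy
      exact Real.smoothTransition.one_of_one_le (le_of_lt hy)
    rw [this.deriv_eq]; simp
  · exact (hK x ⟨h0, h1⟩).trans (le_max_left _ _)

/-- Temporal cut-off functions with the natural scaling of their derivative. -/
theorem exists_temporal_cutoff : ∃ K : ℝ, 0 < K ∧ ∀ r : ℝ, 0 < r → ∃ θ : ℝ → ℝ,
    ContDiff ℝ (⊤ : ℕ∞) θ ∧ (∀ s, 0 ≤ θ s) ∧ (∀ s, θ s ≤ 1) ∧ (∀ s, -r ^ 2 ≤ s → θ s = 1) ∧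
    (∀ s, s ≤ -(2 * r ^ 2) → θ s = 0) ∧ ∀ s, |deriv θ s| ≤ K / r ^ 2 := by
  obtain ⟨K, hK⟩ := exists_abs_deriv_smoothTransition_le
  refine ⟨max 1 K, by positivity, fun r hr => ⟨fun s => Real.smoothTransition (s / r ^ 2 + 2),
    Real.smoothTransition.contDiff.comp ((contDiff_id.div_const _).add contDiff_const),
    fun s => Real.smoothTransition.nonneg _, fun s => Real.smoothTransition.le_one _,
    fun s hs => Real.smoothTransition.one_of_one_le ?_,
    fun s hs => Real.smoothTransition.zero_of_nonpos ?_, fun s => ?_⟩⟩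
  · have : -1 ≤ s / r ^ 2 := by rw [le_div_iff₀ (by positivity)]; linarith
    linarith
  · have : s / r ^ 2 ≤ -2 := by rw [div_le_iff₀ (by positivity)]; linarith
    linarith
  · have hd : HasDerivAt (fun s => s / r ^ 2 + 2) (1 / r ^ 2) s :=
      ((hasDerivAt_id s).div_const _).add_const _
    have hs : DifferentiableAt ℝ Real.smoothTransition (s / r ^ 2 + 2) :=
      (Real.smoothTransition.contDiff (n := 1)).differentiable (by simp) _
    have h := (hs.hasDerivAt.comp s hd).deriv
    simp only [Function.comp_def] at h
    rw [h, abs_mul, abs_of_pos (by positivity : 0 < 1 / r ^ 2), div_eq_mul_one_div (max 1 K)]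
    gcongr
    exact (hK _).trans (le_max_right _ _)

/-- The estimate of the right-hand side of the local energy inequality at a fixed time. Since the
transport term has mean zero, the pressure may be normalized by any constant. -/
theorem abs_integral_energy_flux_le {V : E3 → E3} {P L : E3 → ℝ} {g : Fin 3 → E3 → ℝ}
    {R a b m : ℝ} (hR : R ≤ 1) (ha : 0 ≤ a) (hL : ∀ x, |L x| ≤ b) (hg : ∀ i x, |g i x| ≤ a)
    (hL0 : ∀ x ∉ ballB R, L x = 0) (hg0 : ∀ i, ∀ x ∉ ballB R, g i x = 0)
    (hdiv : ∫ x in ballB 1, ∑ i, V x i * g i x = 0)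
    (hVg : IntegrableOn (fun x => ∑ i, V x i * g i x) (ballB 1))
    (hV2 : IntegrableOn (fun x => ‖V x‖ ^ 2) (ballB R))
    (hV3 : IntegrableOn (fun x => ‖V x‖ ^ 3) (ballB R))
    (hP : IntegrableOn (fun x => |P x - m| ^ (3 / 2 : ℝ)) (ballB R)) :
    |∫ x in ballB 1, (‖V x‖ ^ 2 * L x + (∑ i, V x i * g i x) * (‖V x‖ ^ 2 + 2 * P x))| ≤
      b * (∫ x in ballB R, ‖V x‖ ^ 2) + 9 * a * (∫ x in ballB R, ‖V x‖ ^ 3) +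
        6 * a * ∫ x in ballB R, |P x - m| ^ (3 / 2 : ℝ) := by
  have hb : 0 ≤ b := (abs_nonneg _).trans (hL 0)
  have hsub : ballB R ⊆ ballB 1 := ball_subset_ball hR
  have hms : MeasurableSet (ballB R) := measurableSet_ball
  set F : E3 → ℝ := fun x =>
    ‖V x‖ ^ 2 * L x + (∑ i, V x i * g i x) * (‖V x‖ ^ 2 + 2 * P x) with hF
  set H : E3 → ℝ := fun x =>
    b * ‖V x‖ ^ 2 + 9 * a * ‖V x‖ ^ 3 + 6 * a * |P x - m| ^ (3 / 2 : ℝ) with hH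
  have hH1 : IntegrableOn (fun x => b * ‖V x‖ ^ 2 + 9 * a * ‖V x‖ ^ 3) (ballB R) :=
    (hV2.const_mul b).add (hV3.const_mul (9 * a))
  have hHi : IntegrableOn H (ballB R) := hH1.add (hP.const_mul (6 * a))
  have hHint : ∫ x in ballB R, H x = b * (∫ x in ballB R, ‖V x‖ ^ 2) +
      9 * a * (∫ x in ballB R, ‖V x‖ ^ 3) + 6 * a * ∫ x in ballB R, |P x - m| ^ (3 / 2 : ℝ) := by
    rw [hH, integral_add hH1 (hP.const_mul (6 * a)),
      integral_add (hV2.const_mul b) (hV3.const_mul (9 * a))]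
    simp only [integral_const_mul]
  have hH0 : ∀ x, 0 ≤ H x := fun x => by positivity
  rw [← hHint]
  by_cases hFi : IntegrableOn F (ballB 1)
  swap
  · rw [integral_undef hFi, abs_zero]
    exact integral_nonneg hH0
  have e : ∫ x in ballB 1, F x = ∫ x in ballB 1, (F x - 2 * m * ∑ i, V x i * g i x) := by
    rw [integral_sub hFi (hVg.const_mul _), integral_const_mul, hdiv, mul_zero, sub_zero]
  rw [e, ← inter_eq_right.2 hsub, ← setIntegral_indicator hms, ← Real.norm_eq_abs]
  refine norm_integral_le_of_norm_le ((integrable_indicator_iff hms).2 hHi).integrableOn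
    (Eventually.of_forall fun x => ?_)
  by_cases hx : x ∈ ballB R
  swap
  · simp [hF, hL0 x hx, hg0 _ x hx, hx]
  rw [indicator_of_mem hx, Real.norm_eq_abs]
  have hS : |∑ i, V x i * g i x| ≤ 3 * a * ‖V x‖ := by
    refine (Finset.abs_sum_le_sum_abs _ _).trans ?_
    calc ∑ i, |V x i * g i x| ≤ ∑ _i : Fin 3, ‖V x‖ * a := by
          refine Finset.sum_le_sum fun i _ => ?_
          rw [abs_mul]
          gcongr
          exacts [E3.abs_apply_le _ _, hg i x]
      _ = _ := by simp; ring
  have hY := mul_le_cube_add_rpow_three_halves (norm_nonneg (V x)) (abs_nonneg (P x - m))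
  have e2 : F x - 2 * m * ∑ i, V x i * g i x =
      ‖V x‖ ^ 2 * L x + (∑ i, V x i * g i x) * (‖V x‖ ^ 2 + 2 * (P x - m)) := by
    rw [hF]; ring
  rw [e2]
  calc _ ≤ |‖V x‖ ^ 2 * L x| + |(∑ i, V x i * g i x) * (‖V x‖ ^ 2 + 2 * (P x - m))| :=
        abs_add_le _ _
    _ ≤ ‖V x‖ ^ 2 * b + 3 * a * ‖V x‖ * (‖V x‖ ^ 2 + 2 * |P x - m|) := by
        rw [abs_mul, abs_mul, abs_of_nonneg (by positivity : 0 ≤ ‖V x‖ ^ 2)]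
        gcongr
        · exact hL x
        · refine (abs_add_le _ _).trans (le_of_eq ?_)
          rw [abs_of_nonneg (by positivity : 0 ≤ ‖V x‖ ^ 2), abs_mul, abs_two]
    _ = b * ‖V x‖ ^ 2 + 3 * a * ‖V x‖ ^ 3 + 6 * a * (‖V x‖ * |P x - m|) := by ring
    _ ≤ b * ‖V x‖ ^ 2 + 3 * a * ‖V x‖ ^ 3 + 6 * a * (‖V x‖ ^ 3 + |P x - m| ^ (3 / 2 : ℝ)) := by
        gcongr
    _ = H x := by rw [hH]; ring

/-- Bounds for all initial subintervals, up to a null set of endpoints, pass to the whole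
interval. -/
theorem setIntegral_Ioo_le_of_ae_le {f : ℝ → ℝ} {a b c B : ℝ} (hca : c ≤ a) (hab : a < b)
    (hf : IntegrableOn f (Ioo a b))
    (h : ∀ᵐ t ∂(volume.restrict (Ioo c b)), ∫ s in Ioo a t, f s ≤ B) :
    ∫ s in Ioo a b, f s ≤ B := by
  have hf' : IntegrableOn f (Icc a b) := (integrableOn_Icc_iff_integrableOn_Ioo).2 hf
  have hcont := (intervalIntegral.continuousOn_primitive hf') b (right_mem_Icc.2 hab.le)
  simp only [integral_Ioc_eq_integral_Ioo] at hcont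
  have ht : Tendsto (fun t => ∫ s in Ioo a t, f s) (𝓝[Ioo a b] b) (𝓝 (∫ s in Ioo a b, f s)) :=
    hcont.mono_left (nhdsWithin_mono _ Ioo_subset_Icc_self)
  refine le_of_tendsto_of_frequently ht fun hne => ?_
  rw [nhdsWithin_Ioo_eq_nhdsLT hab] at hne
  obtain ⟨l, hl, hlb⟩ := (mem_nhdsLT_iff_exists_Ioo_subset).1 hne
  have hlb' : max l a < b := max_lt hl hab
  have h0 : volume (Ioo (max l a) b) = 0 := by
    rw [ae_restrict_iff' measurableSet_Ioo] at h
    refine measure_mono_null (fun t htm => ?_) h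
    intro hc
    exact hlb ⟨(le_max_left _ _).trans_lt htm.1, htm.2⟩
      (hc ⟨hca.trans_lt ((le_max_right _ _).trans_lt htm.1), htm.2⟩)
  rw [Real.volume_Ioo, ENNReal.ofReal_eq_zero] at h0
  linarith

theorem integrableOn_slices {f : E3 × ℝ → ℝ} {R : ℝ} (hf : IntegrableOn f (QSet R)) :
    IntegrableOn (fun t => ∫ x in ballB R, f (x, t)) (timeI R) ∧
    (∀ᵐ t ∂(volume.restrict (timeI R)), IntegrableOn (fun x => f (x, t)) (ballB R)) ∧
    ∫ t in timeI R, ∫ x in ballB R, f (x, t) = ∫ z in QSet R, f z := by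
  have hf' : Integrable f (volume.restrict (QSet R)) := hf
  rw [restrict_QSet] at hf'
  exact ⟨hf'.integral_prod_right, hf'.prod_left_ae, by rw [restrict_QSet, integral_prod_symm _ hf']⟩

/-- The upper bound for the energy flux density at time `t`. -/
def fluxDensity (v : E3 → ℝ → E3) (p : E3 → ℝ → ℝ) (a b R t : ℝ) : ℝ :=
  b * (∫ x in ballB R, ‖v x t‖ ^ 2) + 9 * a * (∫ x in ballB R, ‖v x t‖ ^ 3) +
    6 * a * pressureOsc p R t

theorem fluxDensity_nonneg {v : E3 → ℝ → E3} {p : E3 → ℝ → ℝ} {a b R t : ℝ} (ha : 0 ≤ a)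
    (hb : 0 ≤ b) : 0 ≤ fluxDensity v p a b R t := by
  have h1 : 0 ≤ ∫ x in ballB R, ‖v x t‖ ^ 2 := integral_nonneg fun _ => by positivity
  have h2 : 0 ≤ ∫ x in ballB R, ‖v x t‖ ^ 3 := integral_nonneg fun _ => by positivity
  have h3 := pressureOsc_nonneg p R t
  unfold fluxDensity
  positivity

namespace SuitableWeakSolution

variable {v : E3 → ℝ → E3} {gv : E3 → ℝ → Fin 3 → Fin 3 → ℝ} {p : E3 → ℝ → ℝ}

theorem pressure_restrict (h : SuitableWeakSolution v gv p) {R : ℝ} (hR : 0 ≤ R) (hR1 : R ≤ 1) :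
    AEStronglyMeasurable (fun z : E3 × ℝ => p z.1 z.2) (volume.restrict (QSet R)) ∧
    IntegrableOn (fun z : E3 × ℝ => |p z.1 z.2| ^ (3 / 2 : ℝ)) (QSet R) :=
  ⟨h.p_meas.aestronglyMeasurable.mono_measure (Measure.restrict_mono_set _ (QSet_subset hR hR1)),
    h.p_L32.mono_set (QSet_subset hR hR1)⟩

theorem integrableOn_fluxDensity (h : SuitableWeakSolution v gv p) {R : ℝ} (hR : 0 ≤ R)
    (hR1 : R ≤ 1) (a b : ℝ) : IntegrableOn (fluxDensity v p a b R) (timeI R) := by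
  have hQ := QSet_subset hR hR1
  obtain ⟨hpm, hpi⟩ := h.pressure_restrict hR hR1
  exact (((integrableOn_slices (h.vel.v_L2.mono_set hQ)).1.const_mul b).add
    ((integrableOn_slices (h.vel.integrableOn_norm_cube.mono_set hQ)).1.const_mul (9 * a))).add
    ((integrable_pressureOsc hpm hpi).const_mul (6 * a))

/-- The bound for the right-hand side of the local energy inequality, slice by slice. -/
theorem ae_abs_flux_le (h : SuitableWeakSolution v gv p) {ψ : E3 → ℝ} {θ : ℝ → ℝ} {R a b : ℝ}
    (hR : 0 < R) (hR1 : R ≤ 1) (hψ : ContDiff ℝ (⊤ : ℕ∞) ψ) (hθ : ContDiff ℝ (⊤ : ℕ∞) θ)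
    (hψs : tsupport ψ ⊆ ballB R) (hθ0 : ∀ s, 0 ≤ θ s) (hθ1 : ∀ s, θ s ≤ 1)
    (hψ0 : ∀ x, 0 ≤ ψ x) (hψ1 : ∀ x, ψ x ≤ 1)
    (hg : ∀ j x, |fderiv ℝ ψ x (EuclideanSpace.single j (1 : ℝ))| ≤ a)
    (hgg : ∀ j x, |fderiv ℝ (fun y => fderiv ℝ ψ y (EuclideanSpace.single j (1 : ℝ))) x
      (EuclideanSpace.single j (1 : ℝ))| ≤ b)
    (hθd : ∀ s, |deriv θ s| ≤ b) :
    ∀ᵐ s ∂(volume.restrict (timeI R)),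
      |∫ x in ballB 1, (‖v x s‖ ^ 2 * (lapSpace (fun z => ψ z.1 * θ z.2) (x, s) +
          fderiv ℝ (fun z : E3 × ℝ => ψ z.1 * θ z.2) (x, s) timeDir) +
        (∑ i, v x s i * fderiv ℝ (fun z : E3 × ℝ => ψ z.1 * θ z.2) (x, s) (spaceDir i)) *
          (‖v x s‖ ^ 2 + 2 * p x s))| ≤ fluxDensity v p a (4 * b) R s := by
  have hQ := QSet_subset hR.le hR1
  have hT : timeI R ⊆ timeI 1 := Ioo_subset_Ioo_left (by nlinarith)
  obtain ⟨hpm, hpi⟩ := h.pressure_restrict hR.le hR1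
  have ha : 0 ≤ a := (abs_nonneg _).trans (hg 0 0)
  have hd1 : Differentiable ℝ ψ := hψ.differentiable (by simp)
  have hd2 : Differentiable ℝ θ := hθ.differentiable (by simp)
  have hψz : ∀ x ∉ ballB R, ψ x = 0 := fun x hx =>
    image_eq_zero_of_notMem_tsupport fun hx' => hx (hψs hx')
  have hs1 : ∀ j, tsupport (fun y => fderiv ℝ ψ y (EuclideanSpace.single j (1 : ℝ))) ⊆
      tsupport ψ := fun j => tsupport_fderiv_apply_subset ℝ _
  have hgz : ∀ j, ∀ x ∉ ballB R, fderiv ℝ ψ x (EuclideanSpace.single j (1 : ℝ)) = 0 :=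
    fun j x hx => image_eq_zero_of_notMem_tsupport
      (f := fun y => fderiv ℝ ψ y (EuclideanSpace.single j (1 : ℝ)))
      fun hx' => hx (hψs (hs1 j hx'))
  have hggz : ∀ j, ∀ x ∉ ballB R, fderiv ℝ (fun y => fderiv ℝ ψ y
      (EuclideanSpace.single j (1 : ℝ))) x (EuclideanSpace.single j (1 : ℝ)) = 0 :=
    fun j x hx => by
      have hs2 := tsupport_fderiv_subset ℝ
        (f := fun y => fderiv ℝ ψ y (EuclideanSpace.single j (1 : ℝ)))
      have hx2 : x ∉ tsupport (fderiv ℝ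
          fun y => fderiv ℝ ψ y (EuclideanSpace.single j (1 : ℝ))) :=
        fun hx' => hx (hψs (hs1 j (hs2 hx')))
      rw [image_eq_zero_of_notMem_tsupport hx2, zero_apply]
  have hmv : ∀ᵐ s ∂(volume.restrict (timeI 1)), ∀ i,
      Integrable (fun x => v x s i) (volume.restrict (ballB 1)) := by
    rw [ae_all_iff]
    intro i
    filter_upwards [h.vel.ae_memLp_apply i] with s hs
    exact hs.integrable (by norm_num)
  filter_upwards [ae_restrict_of_ae_restrict_of_subset hT hmv,
    ae_restrict_of_ae_restrict_of_subset hT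
      (h.ae_integral_velocity_gradient_eq_zero hψ (hψs.trans (ball_subset_ball hR1))),
    (integrableOn_slices (h.vel.v_L2.mono_set hQ)).2.1,
    (integrableOn_slices (h.vel.integrableOn_norm_cube.mono_set hQ)).2.1,
    ae_slice_pressure hpm hpi] with s hvi hdiv hV2 hV3 hP
  simp only [fderiv_mul_spaceDir hd1 hd2, fderiv_mul_timeDir hd1 hd2,
    lapSpace_mul (by exact_mod_cast contDiff_infty.1 hψ 2) hd2]
  have hθa : |θ s| ≤ 1 := abs_le.2 ⟨by linarith [hθ0 s], hθ1 s⟩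
  refine abs_integral_energy_flux_le hR1 ha (fun x => ?_) (fun i x => ?_) (fun x hx => ?_)
    (fun i x hx => ?_) ?_ ?_ hV2 hV3 (integrable_abs_sub_const_rpow hP.1 hP.2 _)
  · refine (abs_add_le _ _).trans ?_
    rw [abs_mul, abs_mul, abs_of_nonneg (hψ0 x)]
    have h1 : |∑ j, fderiv ℝ (fun y => fderiv ℝ ψ y (EuclideanSpace.single j (1 : ℝ))) x
        (EuclideanSpace.single j (1 : ℝ))| ≤ 3 * b := by
      refine (Finset.abs_sum_le_sum_abs _ _).trans ?_
      refine (Finset.sum_le_sum fun j _ => hgg j x).trans (le_of_eq ?_)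
      simp
    have h2 := mul_le_mul h1 hθa (abs_nonneg _) ((abs_nonneg _).trans h1)
    have h3 := mul_le_mul (hψ1 x) (hθd s) (abs_nonneg _) zero_le_one
    linarith
  · rw [abs_mul]
    have := mul_le_mul (hg i x) hθa (abs_nonneg _) ha
    linarith
  · rw [hψz x hx, Finset.sum_eq_zero fun j _ => hggz j x hx]; simp
  · rw [hgz i x hx, zero_mul]
  · simp_rw [← mul_assoc, ← Finset.sum_mul]
    rw [integral_mul_const, hdiv, zero_mul]
  · refine integrable_finsetSum _ fun i _ => (hvi i).mul_bdd (c := a)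
      (Continuous.aestronglyMeasurable ?_) (Eventually.of_forall fun x => ?_)
    · exact ((hψ.continuous_fderiv (by simp)).clm_apply continuous_const).mul continuous_const
    · rw [norm_mul, Real.norm_eq_abs, Real.norm_eq_abs]
      have := mul_le_mul (hg i x) hθa (abs_nonneg _) ha
      linarith

end SuitableWeakSolution

theorem parabBdry_subset {R S : ℝ} (hR : R < 1) (hS : -1 < S) :
    parabBdry ⊆ {z : E3 × ℝ | R < ‖z.1‖ ∨ z.2 < S} := by
  rintro z (hz | hz)
  · left
    have : ‖z.1‖ = 1 := by simpa using hz.1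
    rwa [this]
  · right
    have : z.2 = -1 := hz.2
    rwa [this]

namespace SuitableWeakSolution

variable {v : E3 → ℝ → E3} {gv : E3 → ℝ → Fin 3 → Fin 3 → ℝ} {p : E3 → ℝ → ℝ}

theorem integral_gradient_le (h : SuitableWeakSolution v gv p) {ψ : E3 → ℝ} {θ : ℝ → ℝ}
    {r a b : ℝ} (hr : 0 < r) (hr1 : 2 * r ≤ 1)
    (hψ : ContDiff ℝ (⊤ : ℕ∞) ψ) (hθ : ContDiff ℝ (⊤ : ℕ∞) θ)
    (hψs : tsupport ψ ⊆ closedBall 0 (3 / 2 * r)) (hθs : ∀ s, s ≤ -(2 * r ^ 2) → θ s = 0)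
    (hψr : ∀ x ∈ ballB r, ψ x = 1) (hθr : ∀ s, -r ^ 2 ≤ s → θ s = 1)
    (hθ0 : ∀ s, 0 ≤ θ s) (hθ1 : ∀ s, θ s ≤ 1)
    (hψ0 : ∀ x, 0 ≤ ψ x) (hψ1 : ∀ x, ψ x ≤ 1)
    (hg : ∀ j x, |fderiv ℝ ψ x (EuclideanSpace.single j (1 : ℝ))| ≤ a)
    (hgg : ∀ j x, |fderiv ℝ (fun y => fderiv ℝ ψ y (EuclideanSpace.single j (1 : ℝ))) x
      (EuclideanSpace.single j (1 : ℝ))| ≤ b)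
    (hθd : ∀ s, |deriv θ s| ≤ b) :
    2 * ∫ t in timeI r, ∫ x in ballB r, ∑ i, ∑ j, (gv x t i j) ^ 2 ≤
      ∫ t in timeI (2 * r), fluxDensity v p a (4 * b) (2 * r) t := by
  have ha : 0 ≤ a := (abs_nonneg _).trans (hg 0 0)
  have hb : 0 ≤ b := (abs_nonneg _).trans (hθd 0)
  have hψs' : tsupport ψ ⊆ ballB (2 * r) :=
    hψs.trans (closedBall_subset_ball (by linarith))
  have hT : timeI (2 * r) ⊆ Ioo (-1) 0 := Ioo_subset_Ioo_left (by nlinarith)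
  have hTm : MeasurableSet (timeI (2 * r)) := measurableSet_Ioo
  have hd1 : Differentiable ℝ ψ := hψ.differentiable (by simp)
  have hd2 : Differentiable ℝ θ := hθ.differentiable (by simp)
  set φ : E3 × ℝ → ℝ := fun z => ψ z.1 * θ z.2 with hφ
  have hφc : ContDiff ℝ (⊤ : ℕ∞) φ := (hψ.comp contDiff_fst).mul (hθ.comp contDiff_snd)
  have hφ0 : ∀ z, 0 ≤ φ z := fun z => mul_nonneg (hψ0 _) (hθ0 _)
  set flux : ℝ → ℝ := fun s => ∫ x in ballB 1,
    (‖v x s‖ ^ 2 * (lapSpace φ (x, s) + fderiv ℝ φ (x, s) timeDir) +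
      (∑ i, v x s i * fderiv ℝ φ (x, s) (spaceDir i)) * (‖v x s‖ ^ 2 + 2 * p x s)) with hflux
  set H := fluxDensity v p a (4 * b) (2 * r) with hH
  have hHi : IntegrableOn H (timeI (2 * r)) :=
    h.integrableOn_fluxDensity (by positivity) hr1 _ _
  have hH0 : ∀ t, 0 ≤ H t := fun t => fluxDensity_nonneg ha (by positivity)
  have hHind : Integrable ((timeI (2 * r)).indicator H) := (integrable_indicator_iff hTm).2 hHi
  have hfl := h.ae_abs_flux_le (by positivity) hr1 hψ hθ hψs' hθ0 hθ1 hψ0 hψ1 hg hgg hθd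
  have hfl' : ∀ᵐ s ∂(volume.restrict (Ioo (-1 : ℝ) 0)),
      ‖flux s‖ ≤ (timeI (2 * r)).indicator H s := by
    rw [ae_restrict_iff' hTm] at hfl
    filter_upwards [ae_restrict_of_ae hfl, ae_restrict_mem measurableSet_Ioo] with s hs hs1
    by_cases hst : s ∈ timeI (2 * r)
    · rw [indicator_of_mem hst]
      exact hs hst
    · have hs2 : s ≤ -(2 * r) ^ 2 := not_lt.1 fun hlt => hst ⟨hlt, hs1.2⟩
      have hs3 : s < -(2 * r ^ 2) := by nlinarith [pow_pos hr 2]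
      have hθz : θ s = 0 := hθs s hs3.le
      have hθdz : deriv θ s = 0 := by
        have : θ =ᶠ[𝓝 s] fun _ => 0 := by
          filter_upwards [Iio_mem_nhds hs3] with y hy
          exact hθs y (le_of_lt hy)
        rw [this.deriv_eq]; simp
      have : flux s = 0 := by
        have hψ2 : ContDiff ℝ 2 ψ := by exact_mod_cast contDiff_infty.1 hψ 2
        simp [hflux, hφ, fderiv_mul_spaceDir hd1 hd2, fderiv_mul_timeDir hd1 hd2,
          lapSpace_mul hψ2 hd2, hθz, hθdz]
      rw [this, norm_zero]
      exact indicator_nonneg (fun t _ => hH0 t) s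
  have hgi : IntegrableOn (fun z : E3 × ℝ => φ z * ∑ i, ∑ j, (gv z.1 z.2 i j) ^ 2) (QSet 1) := by
    refine Integrable.bdd_mul (c := 1) h.vel.grad_L2 hφc.continuous.aestronglyMeasurable
      (Eventually.of_forall fun z => ?_)
    rw [Real.norm_of_nonneg (hφ0 z)]
    exact mul_le_one₀ (hψ1 _) (hθ0 _) (hθ1 _)
  obtain ⟨hGi, hGs, -⟩ := integrableOn_slices hgi
  set G : ℝ → ℝ := fun s => ∫ x in ballB 1, φ (x, s) * ∑ i, ∑ j, (gv x s i j) ^ 2 with hG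
  have hG0 : ∀ s, 0 ≤ G s := fun s => integral_nonneg fun x => mul_nonneg (hφ0 _) (by positivity)
  have hrT : timeI r ⊆ timeI 1 := Ioo_subset_Ioo_left (by nlinarith)
  have hQr : QSet r ⊆ QSet 1 := QSet_subset hr.le (by linarith)
  have hEG : ∀ᵐ s ∂(volume.restrict (timeI r)),
      ∫ x in ballB r, ∑ i, ∑ j, (gv x s i j) ^ 2 ≤ G s := by
    filter_upwards [ae_restrict_of_ae_restrict_of_subset hrT hGs,
      ae_restrict_mem (measurableSet_Ioo : MeasurableSet (timeI r))] with s hs hsr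
    calc ∫ x in ballB r, ∑ i, ∑ j, (gv x s i j) ^ 2
        = ∫ x in ballB r, φ (x, s) * ∑ i, ∑ j, (gv x s i j) ^ 2 := by
          refine setIntegral_congr_fun measurableSet_ball fun x hx => ?_
          simp [hφ, hψr x hx, hθr s hsr.1.le]
      _ ≤ G s := setIntegral_mono_set hs
          (Eventually.of_forall fun x => mul_nonneg (hφ0 _) (by positivity))
          (ball_subset_ball (by linarith) : ballB r ⊆ ballB 1).eventuallyLE
  have hEi := (integrableOn_slices (h.vel.grad_L2.mono_set hQr)).1
  suffices hsuf : ∫ t in timeI r, ∫ x in ballB r, ∑ i, ∑ j, (gv x t i j) ^ 2 ≤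
      (∫ t in timeI (2 * r), H t) / 2 by linarith
  refine setIntegral_Ioo_le_of_ae_le (c := -1) (by nlinarith) (by nlinarith [pow_pos hr 2]) hEi ?_
  filter_upwards [h.lei, ae_restrict_mem measurableSet_Ioo] with t ht htm
  have hle := ht φ hφc hφ0 ⟨{z | 3 / 2 * r < ‖z.1‖ ∨ z.2 < -(2 * r ^ 2)},
    (isOpen_lt continuous_const continuous_fst.norm).union
      (isOpen_lt continuous_snd continuous_const),
    parabBdry_subset (by linarith) (by nlinarith), ?_⟩
  swap
  · rintro z (hz | hz)
    · have : ψ z.1 = 0 := image_eq_zero_of_notMem_tsupport fun hz' =>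
        absurd (mem_closedBall_zero_iff.1 (hψs hz')) (not_le.2 hz)
      simp [hφ, this]
    · simp [hφ, hθs z.2 (le_of_lt hz)]
  have h0 : 0 ≤ ∫ x in ballB 1, φ (x, t) * ‖v x t‖ ^ 2 :=
    integral_nonneg fun x => mul_nonneg (hφ0 _) (by positivity)
  have hsubt : Ioo (-1) t ⊆ Ioo (-1 : ℝ) 0 := Ioo_subset_Ioo_right htm.2.le
  have hup : ∫ s in Ioo (-1) t, flux s ≤ ∫ s in timeI (2 * r), H s := by
    refine (le_abs_self _).trans ((norm_integral_le_of_norm_le hHind.integrableOn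
      (ae_restrict_of_ae_restrict_of_subset hsubt hfl')).trans ?_)
    refine (setIntegral_le_integral hHind (Eventually.of_forall
      (indicator_nonneg fun t _ => hH0 t))).trans (le_of_eq (integral_indicator hTm))
  have hGi' : IntegrableOn G (Ioo (-1) 0) := by simpa [timeI] using hGi
  have hlow : ∫ s in Ioo (-r ^ 2) t, ∫ x in ballB r, ∑ i, ∑ j, (gv x s i j) ^ 2 ≤
      ∫ s in Ioo (-1) t, G s := by
    have hs1 : Ioo (-r ^ 2) t ⊆ timeI r := Ioo_subset_Ioo_right htm.2.le
    have hs2 : Ioo (-r ^ 2) t ⊆ Ioo (-1) t := Ioo_subset_Ioo_left (by nlinarith)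
    have hGt := hGi'.mono_set hsubt
    calc _ ≤ ∫ s in Ioo (-r ^ 2) t, G s :=
          integral_mono_ae (hEi.mono_set hs1) (hGt.mono_set hs2)
            (ae_restrict_of_ae_restrict_of_subset hs1 hEG)
      _ ≤ _ := setIntegral_mono_set hGt (Eventually.of_forall hG0) hs2.eventuallyLE
  linarith

end SuitableWeakSolution

theorem volume_real_QSet {R : ℝ} (hR : 0 ≤ R) :
    (volume : Measure (E3 × ℝ)).real (QSet R) = R ^ 5 * (volume : Measure E3).real (ballB 1) := by
  have h1 : (volume : Measure E3).real (ballB R) =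
      R ^ 3 * (volume : Measure E3).real (ballB 1) := by
    simp only [Measure.real, ballB]
    rw [Measure.addHaar_ball _ _ hR, ENNReal.toReal_mul, ENNReal.toReal_ofReal (by positivity),
      finrank_euclideanSpace_fin]
  rw [QSet, Measure.volume_eq_prod, measureReal_prod_prod, h1, timeI, Real.volume_real_Ioo,
    max_eq_left (by nlinarith)]
  ring

theorem integral_norm_sq_le_rpow {α : Type*} [MeasurableSpace α] {μ : Measure α}
    [IsFiniteMeasure μ] {f : α → E3} (hf : AEStronglyMeasurable f μ)
    (h3 : Integrable (fun x => ‖f x‖ ^ 3) μ) :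
    ∫ x, ‖f x‖ ^ 2 ∂μ ≤ (∫ x, ‖f x‖ ^ 3 ∂μ) ^ (2 / 3 : ℝ) * μ.real univ ^ (1 / 3 : ℝ) := by
  have hpq : (3 / 2 : ℝ).HolderConjugate 3 :=
    Real.holderConjugate_iff.2 ⟨by norm_num, by norm_num⟩
  have e : ∀ x, (‖f x‖ ^ 2) ^ (3 / 2 : ℝ) = ‖f x‖ ^ 3 := fun x => by
    rw [← Real.rpow_natCast, ← Real.rpow_mul (norm_nonneg _), ← Real.rpow_natCast]
    norm_num
  have hm : MemLp (fun x => ‖f x‖ ^ 2) (ENNReal.ofReal (3 / 2)) μ := by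
    have hm2 : AEStronglyMeasurable (fun x => ‖f x‖ ^ 2) μ := hf.norm.pow 2
    rw [← integrable_norm_rpow_iff hm2 (by simp) (by simp),
      ENNReal.toReal_ofReal (by norm_num)]
    refine h3.congr (Eventually.of_forall fun x => ?_)
    beta_reduce
    rw [Real.norm_of_nonneg (by positivity), e]
  have h := integral_mul_le_Lp_mul_Lq_of_nonneg hpq (Eventually.of_forall fun x => by positivity)
    (Eventually.of_forall fun _ => zero_le_one) hm (memLp_const (1 : ℝ))
  simp only [mul_one, e, Real.one_rpow, integral_const, smul_eq_mul] at h
  convert h using 3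
  norm_num

theorem funC_nonneg (v : E3 → ℝ → E3) (R : ℝ) : 0 ≤ funC v R :=
  mul_nonneg (by positivity) (integral_nonneg fun _ => integral_nonneg fun _ => by positivity)

theorem funD0_nonneg (p : E3 → ℝ → ℝ) (R : ℝ) : 0 ≤ funD0 p R :=
  mul_nonneg (by positivity) (integral_nonneg fun _ => pressureOsc_nonneg p R _)

namespace SuitableWeakSolution

variable {v : E3 → ℝ → E3} {gv : E3 → ℝ → Fin 3 → Fin 3 → ℝ} {p : E3 → ℝ → ℝ}

theorem integral_cube_le (h : SuitableWeakSolution v gv p) {R ϱ : ℝ} (hR : 0 < R) (hRϱ : R ≤ ϱ)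
    (hϱ : ϱ ≤ 1) :
    ∫ t in timeI R, ∫ x in ballB R, ‖v x t‖ ^ 3 ≤ ϱ ^ 2 * funC v ϱ := by
  have hϱ0 : 0 < ϱ := hR.trans_le hRϱ
  have h3 := h.vel.integrableOn_norm_cube.mono_set (QSet_subset hϱ0.le hϱ)
  have h3' := h3.mono_set (QSet_subset hR.le hRϱ)
  rw [funC, ← mul_assoc, mul_one_div_cancel (by positivity), one_mul,
    (integrableOn_slices h3).2.2, (integrableOn_slices h3').2.2]
  exact setIntegral_mono_set h3 (Eventually.of_forall fun _ => by positivity)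
    (QSet_subset hR.le hRϱ).eventuallyLE

theorem integral_sq_le (h : SuitableWeakSolution v gv p) {R ϱ : ℝ} (hR : 0 < R) (hRϱ : R ≤ ϱ)
    (hϱ : ϱ ≤ 1) :
    ∫ t in timeI R, ∫ x in ballB R, ‖v x t‖ ^ 2 ≤ (ϱ ^ 2 * funC v ϱ) ^ (2 / 3 : ℝ) *
      (R ^ 5 * (volume : Measure E3).real (ballB 1)) ^ (1 / 3 : ℝ) := by
  have hQ : QSet R ⊆ QSet 1 := QSet_subset hR.le (hRϱ.trans hϱ)
  have h3 := h.vel.integrableOn_norm_cube.mono_set hQ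
  have hfin : IsFiniteMeasure ((volume : Measure (E3 × ℝ)).restrict (QSet R)) := by
    rw [restrict_QSet]; infer_instance
  have hH := integral_norm_sq_le_rpow
    (h.vel.v_meas.aestronglyMeasurable.mono_measure (Measure.restrict_mono_set _ hQ)) h3
  rw [measureReal_restrict_apply_univ, volume_real_QSet hR.le,
    ← (integrableOn_slices (h.vel.v_L2.mono_set hQ)).2.2, ← (integrableOn_slices h3).2.2] at hH
  refine hH.trans ?_
  have := h.integral_cube_le hR hRϱ hϱ
  have h0 : 0 ≤ ∫ t in timeI R, ∫ x in ballB R, ‖v x t‖ ^ 3 :=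
    integral_nonneg fun _ => integral_nonneg fun _ => by positivity
  gcongr

theorem integral_fluxDensity (h : SuitableWeakSolution v gv p) {R : ℝ} (hR : 0 < R) (hR1 : R ≤ 1)
    (a b : ℝ) :
    ∫ t in timeI R, fluxDensity v p a b R t =
      b * (∫ t in timeI R, ∫ x in ballB R, ‖v x t‖ ^ 2) +
        9 * a * (∫ t in timeI R, ∫ x in ballB R, ‖v x t‖ ^ 3) + 6 * a * (R ^ 2 * funD0 p R) := by
  have hQ := QSet_subset hR.le hR1
  obtain ⟨hpm, hpi⟩ := h.pressure_restrict hR.le hR1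
  have i2 : IntegrableOn (fun t => b * ∫ x in ballB R, ‖v x t‖ ^ 2) (timeI R) :=
    (integrableOn_slices (h.vel.v_L2.mono_set hQ)).1.const_mul b
  have i3 : IntegrableOn (fun t => 9 * a * ∫ x in ballB R, ‖v x t‖ ^ 3) (timeI R) :=
    (integrableOn_slices (h.vel.integrableOn_norm_cube.mono_set hQ)).1.const_mul (9 * a)
  have i4 := (integrable_pressureOsc hpm hpi).const_mul (6 * a)
  have e : R ^ 2 * funD0 p R = ∫ t in timeI R, pressureOsc p R t := by
    rw [funD0, ← mul_assoc, mul_one_div_cancel (by positivity), one_mul]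
    rfl
  rw [e]
  simp only [fluxDensity]
  have i23 : IntegrableOn (fun t => b * (∫ x in ballB R, ‖v x t‖ ^ 2) +
      9 * a * ∫ x in ballB R, ‖v x t‖ ^ 3) (timeI R) := i2.add i3
  rw [integral_add i23 i4, integral_add i2 i3]
  simp only [integral_const_mul]

end SuitableWeakSolution

theorem rpow_scaling_identity {r ϱ C w : ℝ} (hr : 0 < r) (hϱ : 0 < ϱ) (hC : 0 ≤ C) (hw : 0 ≤ w) :
    1 / r ^ 3 * ((ϱ ^ 2 * C) ^ (2 / 3 : ℝ) * ((2 * r) ^ 5 * w) ^ (1 / 3 : ℝ)) =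
      (32 * w) ^ (1 / 3 : ℝ) * ((ϱ / r) ^ (4 / 3 : ℝ) * C ^ (2 / 3 : ℝ)) := by
  have e1 : (2 * r) ^ 5 * w = r ^ 5 * (32 * w) := by ring
  have e2 : (r ^ 5) ^ (1 / 3 : ℝ) = r ^ (5 / 3 : ℝ) := by
    rw [← Real.rpow_natCast, ← Real.rpow_mul hr.le]; norm_num
  have e3 : (ϱ ^ 2) ^ (2 / 3 : ℝ) = ϱ ^ (4 / 3 : ℝ) := by
    rw [← Real.rpow_natCast, ← Real.rpow_mul hϱ.le]; norm_num
  have e4 : r ^ 3 = r ^ (5 / 3 : ℝ) * r ^ (4 / 3 : ℝ) := by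
    rw [← Real.rpow_add hr, ← Real.rpow_natCast]; norm_num
  rw [e1, Real.mul_rpow (by positivity) (by positivity), Real.mul_rpow (by positivity : 0 ≤ r ^ 5) (by positivity), e2, e3,
    Real.div_rpow hϱ.le hr.le, e4]
  field_simp

/-- Inequality (5.2) in the proof of Lemma 1.8: there is a universal `c > 0` such that for
every suitable weak solution and all `0 < r ≤ ϱ/2 < ϱ ≤ 1`,
`E(r) + D₀(r) ≤ c [D₀(2r) + (ϱ/r)² C(ϱ) + (ϱ/r)^{4/3} C^{2/3}(ϱ)]`. -/
theorem inequality_52 :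
    ∃ c : ℝ, 0 < c ∧
      ∀ (v : E3 → ℝ → E3) (gv : E3 → ℝ → Fin 3 → Fin 3 → ℝ) (p : E3 → ℝ → ℝ),
        SuitableWeakSolution v gv p →
        ∀ r ϱ : ℝ, 0 < r → r ≤ ϱ / 2 → ϱ ≤ 1 →
          funE gv r + funD0 p r
            ≤ c * (funD0 p (2 * r) + (ϱ / r) ^ 2 * funC v ϱ
                + (ϱ / r) ^ ((4 : ℝ) / 3) * funC v ϱ ^ ((2 : ℝ) / 3)) := by
  obtain ⟨K₁, hK₁, hspace⟩ := exists_spatial_cutoff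
  obtain ⟨K₂, hK₂, htime⟩ := exists_temporal_cutoff
  set w := (volume : Measure E3).real (ballB 1) with hw
  have hw0 : 0 ≤ w := measureReal_nonneg
  set K := max K₁ K₂ with hK
  have hK0 : 0 < K := lt_max_of_lt_left hK₁
  refine ⟨16 + 24 * K + 9 * K + 4 * K * (32 * w) ^ (1 / 3 : ℝ), by positivity,
    fun v gv p h r ϱ hr hrϱ hϱ => ?_⟩
  have hϱ0 : 0 < ϱ := by linarith
  have hR : 0 < 2 * r := by positivity
  have hR1 : 2 * r ≤ 1 := by linarith
  obtain ⟨ψ, hψ, hψ0, hψ1, hψr, hψs, hg, hgg⟩ := hspace r hr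
  obtain ⟨θ, hθ, hθ0, hθ1, hθr, hθs, hθd⟩ := htime r hr
  have hE := h.integral_gradient_le (a := K / r) (b := K / r ^ 2) hr hR1 hψ hθ hψs hθs hψr hθr
    hθ0 hθ1 hψ0 hψ1
    (fun j x => (hg j x).trans (by gcongr; exact le_max_left _ _))
    (fun j x => (hgg j x).trans (by gcongr; exact le_max_left _ _))
    (fun s => (hθd s).trans (by gcongr; exact le_max_right _ _))
  rw [h.integral_fluxDensity hR hR1] at hE
  have hC := h.integral_cube_le hR (by linarith : 2 * r ≤ ϱ) hϱ
  have hV := h.integral_sq_le hR (by linarith : 2 * r ≤ ϱ) hϱ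
  have hD : funD0 p r ≤ 16 * funD0 p (2 * r) := by
    obtain ⟨hpm, hpi⟩ := h.pressure_restrict hR.le hR1
    refine (funD0_le_of_le hr (by linarith) hpm hpi).trans (le_of_eq ?_)
    rw [mul_div_cancel_right₀ _ hr.ne']
    norm_num
  have hC0 := funC_nonneg v ϱ
  have hD0 := funD0_nonneg p (2 * r)
  set D := funD0 p (2 * r)
  set C := funC v ϱ
  set X := (ϱ / r) ^ 2 * C with hX
  set Y := (ϱ / r) ^ ((4 : ℝ) / 3) * C ^ ((2 : ℝ) / 3) with hY
  set κ := (32 * w) ^ (1 / 3 : ℝ)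
  have hX0 : 0 ≤ X := by positivity
  have hY0 : 0 ≤ Y := by positivity
  have hκ0 : 0 ≤ κ := by positivity
  have hE2 : 2 * funE gv r ≤ 4 * K * (κ * Y) + 9 * K * X + 24 * K * D := by
    rw [← rpow_scaling_identity hr hϱ0 hC0 hw0, hX]
    calc 2 * funE gv r
        = 1 / r * (2 * ∫ t in timeI r, ∫ x in ballB r, ∑ i, ∑ j, (gv x t i j) ^ 2) := by
          rw [funE]; ring
      _ ≤ 1 / r * (4 * (K / r ^ 2) * ((ϱ ^ 2 * C) ^ (2 / 3 : ℝ) *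
            ((2 * r) ^ 5 * w) ^ (1 / 3 : ℝ)) + 9 * (K / r) * (ϱ ^ 2 * C) +
            6 * (K / r) * ((2 * r) ^ 2 * D)) := by
          refine mul_le_mul_of_nonneg_left (hE.trans ?_) (by positivity)
          gcongr
      _ = _ := by
          field_simp
          ring
  have hE0 : 0 ≤ funE gv r := by
    refine mul_nonneg (by positivity) (integral_nonneg fun _ => integral_nonneg fun _ => ?_)
    positivity
  have p1 : 0 ≤ K * D := by positivity
  have p2 : 0 ≤ K * X := by positivity
  have p3 : 0 ≤ K * Y := by positivity
  have p4 : 0 ≤ K * κ * D := by positivity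
  have p5 : 0 ≤ K * κ * X := by positivity
  linarith
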